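/- arXiv:2301.11625 — 6 statements merged into one kernel-verified Lean document; each statement's English description precedes it below -/
import Mathlib

section
/- For all real t, the integral over (0,∞) of (cos(tx) − 1)·(π/2)·csch²(πx/2) dx equals 1 − t·coth(t) (with the right side interpreted as 0 at t = 0). -/
open Real MeasureTheory

lemma aux_cot (t : ℝ) (ht : t ≠ 0) :
    HasSum (fun n : ℕ => -(2 * t ^ 2) / (((n + 1 : ℝ) * π) ^ 2 + t ^ 2))
      (1 - t * (Real.cosh t / Real.sinh t)) := by
  have hpi : (π : ℂ) ≠ 0 := by exact_mod_cast Real.pi_ne_zero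
  have htc : (t : ℂ) ≠ 0 := by exact_mod_cast ht
  have hsh : Complex.sinh t ≠ 0 := by
    rw [← Complex.ofReal_sinh]
    exact_mod_cast (by simpa using ht : Real.sinh t ≠ 0)
  set x : ℂ := t * Complex.I / π with hx
  have hxim : x.im = t / π := by
    have : x = ((t / π : ℝ) : ℂ) * Complex.I := by rw [hx]; push_cast; ring
    rw [this, Complex.mul_I_im, Complex.ofReal_re]
  have hmem : x ∈ Complex.integerComplement := by
    rintro ⟨m, hm⟩
    have := congrArg Complex.im hm
    rw [hxim] at this
    simp only [Complex.intCast_im] at this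
    exact (div_ne_zero ht Real.pi_ne_zero) this.symm
  have hne : ∀ r : ℝ, x + r ≠ 0 := by
    intro r h
    have := congrArg Complex.im h
    simp only [Complex.add_im, hxim, Complex.ofReal_im, Complex.zero_im, add_zero] at this
    exact (div_ne_zero ht Real.pi_ne_zero) this
  have hS : HasSum (fun n : ℕ => (1 / (x - (n + 1)) + 1 / (x + (n + 1))))
      (π * Complex.cot (π * x) - 1 / x) := by
    rw [cot_series_rep' hmem]
    exact (summable_cotTerm hmem).hasSum
  have hS2 := hS.mul_left (-x)
  have hx0 : x ≠ 0 := by simpa using hne 0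
  rw [← Complex.hasSum_ofReal]
  convert! hS2 using 1
  · ext n
    have h1 : x - (n + 1) ≠ 0 := by
      have := hne (-(n + 1)); push_cast at this; rwa [← sub_eq_add_neg] at this
    have h2 : x + (n + 1) ≠ 0 := by
      have := hne (n + 1); push_cast at this; exact this
    have h3 : (((n + 1 : ℂ) * π) ^ 2 + t ^ 2) ≠ 0 := by
      have : (((n + 1 : ℝ) * π) ^ 2 + t ^ 2) ≠ 0 := by positivity
      exact_mod_cast this
    have h4 : x ^ 2 * π ^ 2 = - t ^ 2 := by
      rw [hx]; field_simp; rw [Complex.I_sq]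
    push_cast
    rw [div_add_div _ _ h1 h2, ← mul_div_assoc, div_eq_div_iff h3 (mul_ne_zero h1 h2)]
    have h5 : (t : ℂ) ^ 2 = - (x ^ 2 * π ^ 2) := by rw [h4]; ring
    rw [h5]; ring
  · have e : (π : ℂ) * x = t * Complex.I := by rw [hx]; field_simp
    rw [mul_sub, e, Complex.cot, Complex.cos_mul_I, Complex.sin_mul_I]
    have e2 : -x * (1 / x) = -1 := by field_simp
    rw [e2]
    push_cast
    rw [hx]
    have := Complex.I_ne_zero
    field_simp
    ring

lemma aux_cos (t a : ℝ) (ha : 0 < a) :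
    IntegrableOn (fun x : ℝ => Real.cos (t * x) * Real.exp (-a * x)) (Set.Ioi 0) ∧
    ∫ x in Set.Ioi (0:ℝ), Real.cos (t * x) * Real.exp (-a * x) = a / (a ^ 2 + t ^ 2) := by
  set c : ℂ := -a + t * Complex.I with hc
  have hre : c.re < 0 := by simp [hc, ha]
  have hi := integrableOn_exp_mul_complex_Ioi hre 0
  have hv := integral_exp_mul_complex_Ioi hre 0
  have hf : ∀ x : ℝ, (Complex.exp (c * x)).re = Real.cos (t * x) * Real.exp (-a * x) := by
    intro x
    rw [Complex.exp_re]
    simp [hc, mul_comm]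
  constructor
  · have := hi.re
    refine this.congr (Filter.Eventually.of_forall fun x => ?_)
    simpa using hf x
  · have h := integral_re hi
    simp only [RCLike.re_to_complex, hf] at h
    rw [h, hv]
    simp [hc, Complex.div_re, Complex.normSq_apply]
    ring

lemma aux_term (t a : ℝ) (ha : 0 < a) :
    IntegrableOn (fun x : ℝ => 2 * a * ((Real.cos (t * x) - 1) * Real.exp (-a * x))) (Set.Ioi 0) ∧
    ∫ x in Set.Ioi (0:ℝ), 2 * a * ((Real.cos (t * x) - 1) * Real.exp (-a * x))
      = -(2 * t ^ 2) / (a ^ 2 + t ^ 2) := by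
  obtain ⟨h1, h2⟩ := aux_cos t a ha
  obtain ⟨h3, h4⟩ := aux_cos 0 a ha
  simp only [zero_mul, Real.cos_zero] at h3 h4
  simp only [sub_mul]
  refine ⟨(h1.sub h3).const_mul _, ?_⟩
  rw [integral_const_mul, integral_sub h1 h3, h2, h4]
  have : a ^ 2 + t ^ 2 ≠ 0 := by positivity
  field_simp
  ring

lemma aux_csch (x : ℝ) (hx : 0 < x) :
    HasSum (fun n : ℕ => 4 * ((n + 1 : ℝ) * Real.exp (-((n + 1) * π) * x)))
      ((1 / Real.sinh (π * x / 2)) ^ 2) := by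
  have hr : ‖Real.exp (-(π * x))‖ < 1 := by
    rw [Real.norm_eq_abs, abs_of_pos (Real.exp_pos _), Real.exp_lt_one_iff]
    have := mul_pos Real.pi_pos hx
    linarith
  have h := hasSum_coe_mul_geometric_of_norm_lt_one hr
  rw [← hasSum_nat_add_iff' 1] at h
  have h := h.mul_left 4
  convert! h using 1
  · ext n
    rw [← Real.exp_nat_mul]
    push_cast
    ring_nf
  · have hy : 0 < π * x / 2 := by positivity
    set y := π * x / 2 with hyd
    have e1 : Real.exp (-(π * x)) = (Real.exp y ^ 2)⁻¹ := by
      rw [← Real.exp_nat_mul, ← Real.exp_neg]; congr 1; rw [hyd]; push_cast; ring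
    have h1 : 1 < Real.exp y := by simpa using hy
    rw [e1, Real.sinh_eq, Real.exp_neg]
    have h0 := Real.exp_pos y
    generalize Real.exp y = E at *
    have h2 : E ^ 2 - 1 ≠ 0 := by nlinarith
    have e3 : 1 - (E ^ 2)⁻¹ = (E ^ 2 - 1) / E ^ 2 := by field_simp
    have e4 : (E - E⁻¹) / 2 = (E ^ 2 - 1) / (2 * E) := by field_simp
    rw [e3, e4]
    simp
    field_simp
    ring

theorem stmt_0 (t : ℝ) :
    ∫ x in Set.Ioi (0:ℝ),
      (Real.cos (t * x) - 1) * (π / 2) * (1 / Real.sinh (π * x / 2)) ^ 2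
    = if t = 0 then 0 else 1 - t * (Real.cosh t / Real.sinh t) := by
  split_ifs with ht
  · simp [ht]
  have hs := aux_cot t ht
  have hpos : ∀ n : ℕ, 0 < (n + 1 : ℝ) * π := fun n => by positivity
  have hsum := hasSum_integral_of_summable_integral_norm
    (μ := volume.restrict (Set.Ioi (0:ℝ)))
    (F := fun (n : ℕ) (x : ℝ) => 2 * ((n + 1 : ℝ) * π) *
      ((Real.cos (t * x) - 1) * Real.exp (-((n + 1 : ℝ) * π) * x)))
    (fun n => (aux_term t _ (hpos n)).1) (by
      refine hs.summable.neg.congr fun n => ?_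
      rw [← (aux_term t _ (hpos n)).2, ← integral_neg]
      congr 1
      ext x
      rw [Real.norm_eq_abs, abs_of_nonpos]
      refine mul_nonpos_of_nonneg_of_nonpos (by positivity)
        (mul_nonpos_of_nonpos_of_nonneg ?_ (Real.exp_pos _).le)
      linarith [Real.cos_le_one (t * x)])
  simp only [fun n : ℕ => (aux_term t _ (hpos n)).2] at hsum
  rw [hs.unique hsum]
  refine setIntegral_congr_fun measurableSet_Ioi fun x hx => ?_
  have h := (aux_csch x hx).mul_left ((Real.cos (t * x) - 1) * (π / 2))
  rw [← h.tsum_eq]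
  congr 1
  ext n
  ring
end

section
/- For all real t, the integral over (0,∞) of (cos(tx) − 1)·(π/2)·csch²(πx/2)·(πx·coth(πx/2) − 1) dx equals t²·csch²(t) − t·coth(t) (interpreted as 0 at t = 0). -/
open Real MeasureTheory

open Filter Topology in
lemma aux_tendsto (a : ℝ) (ha : 0 < a) (k : ℕ) :
    Tendsto (fun x : ℝ => x ^ k * Real.exp (-(a * x))) atTop (𝓝 0) := by
  have h := (tendsto_pow_mul_exp_neg_atTop_nhds_zero k).comp
    (tendsto_id.const_mul_atTop ha : Tendsto (fun x : ℝ => a * x) atTop atTop)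
  have h2 := h.const_mul ((a ^ k)⁻¹)
  rw [mul_zero] at h2
  refine h2.congr fun x => ?_
  simp only [Function.comp, mul_pow]
  field_simp

lemma aux_expderiv (a x : ℝ) :
    HasDerivAt (fun x : ℝ => Real.exp (-(a * x))) (-a * Real.exp (-(a * x))) x := by
  have h0 : HasDerivAt (fun x : ℝ => -(a * x)) (-a) x := by
    simpa using ((hasDerivAt_id' x).const_mul a).fun_neg
  exact h0.exp.congr_deriv (by ring)

open Filter Topology in
lemma aux_B (a : ℝ) (ha : 0 < a) :
    IntegrableOn (fun x : ℝ => x ^ 2 * (a * x + 1) * Real.exp (-(a * x))) (Set.Ioi 0) ∧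
    ∫ x in Set.Ioi (0:ℝ), x ^ 2 * (a * x + 1) * Real.exp (-(a * x)) = 8 / a ^ 3 := by
  set G : ℝ → ℝ := fun x =>
    -((x ^ 3 + 4 / a * x ^ 2 + 8 / a ^ 2 * x + 8 / a ^ 3) * Real.exp (-(a * x))) with hG
  have hd : ∀ x ∈ Set.Ici (0:ℝ), HasDerivAt G
      (x ^ 2 * (a * x + 1) * Real.exp (-(a * x))) x := by
    intro x _
    have h1 : HasDerivAt (fun x : ℝ => x ^ 3 + 4 / a * x ^ 2 + 8 / a ^ 2 * x + 8 / a ^ 3)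
        (3 * x ^ 2 + 4 / a * (2 * x) + 8 / a ^ 2) x := by
      have := ((((hasDerivAt_pow 3 x).add ((hasDerivAt_pow 2 x).const_mul (4 / a))).add
        ((hasDerivAt_id' x).const_mul (8 / a ^ 2))).add_const (8 / a ^ 3))
      exact this.congr_deriv (by push_cast; ring)
    have h2 := (h1.mul (aux_expderiv a x)).neg
    refine h2.congr_deriv ?_
    field_simp
    ring
  have ht : Tendsto G atTop (𝓝 0) := by
    have := ((((aux_tendsto a ha 3).add ((aux_tendsto a ha 2).const_mul (4 / a))).add
      ((aux_tendsto a ha 1).const_mul (8 / a ^ 2))).add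
      ((aux_tendsto a ha 0).const_mul (8 / a ^ 3))).neg
    simp only [mul_zero, add_zero, neg_zero] at this
    refine this.congr fun x => ?_
    simp only [hG]
    ring
  have hi := integrableOn_Ioi_deriv_of_nonneg' hd (fun x hx => by
    have : 0 < x := hx
    positivity) ht
  refine ⟨hi, ?_⟩
  rw [integral_Ioi_of_hasDerivAt_of_tendsto' hd hi ht]
  simp [hG]

noncomputable def auxF (t a x : ℝ) : ℝ :=
  (Real.cos (t * x) - 1) * (2 * a) * (a * x - 1) * Real.exp (-(a * x))

lemma auxF_bound (t a x : ℝ) (ha : 0 < a) (hx : 0 < x) :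
    ‖auxF t a x‖ ≤ a * t ^ 2 * (x ^ 2 * (a * x + 1) * Real.exp (-(a * x))) := by
  unfold auxF
  rw [norm_mul, norm_mul, norm_mul, Real.norm_eq_abs, Real.norm_eq_abs, Real.norm_eq_abs,
    Real.norm_eq_abs, abs_of_pos (Real.exp_pos _), abs_of_pos (by positivity : 0 < 2 * a)]
  have h1 : |Real.cos (t * x) - 1| ≤ (t * x) ^ 2 / 2 := by
    rw [abs_le]
    constructor
    · linarith [Real.one_sub_sq_div_two_le_cos (x := t * x)]
    · have := Real.cos_le_one (t * x)
      have : 0 ≤ (t * x) ^ 2 / 2 := by positivity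
      linarith
  have h2 : |a * x - 1| ≤ a * x + 1 := by
    have : 0 < a * x := by positivity
    rw [abs_le]; constructor <;> linarith
  calc _ ≤ (t * x) ^ 2 / 2 * (2 * a) * (a * x + 1) * Real.exp (-(a * x)) := by gcongr
    _ = _ := by ring

lemma auxF_int (t a : ℝ) (ha : 0 < a) : IntegrableOn (auxF t a) (Set.Ioi 0) := by
  refine Integrable.mono' ((aux_B a ha).1.const_mul (a * t ^ 2)) ?_ ?_
  · apply Continuous.aestronglyMeasurable
    unfold auxF
    fun_prop
  · filter_upwards [ae_restrict_mem measurableSet_Ioi] with x hx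
    exact auxF_bound t a x ha hx

lemma auxF_norm (t a : ℝ) (ha : 0 < a) :
    ∫ x in Set.Ioi (0:ℝ), ‖auxF t a x‖ ≤ 8 * t ^ 2 / a ^ 2 := by
  have := setIntegral_mono_on (auxF_int t a ha).norm ((aux_B a ha).1.const_mul (a * t ^ 2))
    measurableSet_Ioi (fun x hx => auxF_bound t a x ha hx)
  rw [integral_const_mul, (aux_B a ha).2] at this
  refine this.trans (le_of_eq ?_)
  field_simp

open Filter Topology in
lemma auxF_val (t a : ℝ) (ha : 0 < a) :
    ∫ x in Set.Ioi (0:ℝ), auxF t a x = -(4 * a ^ 2 * t ^ 2 / (t ^ 2 + a ^ 2) ^ 2) := by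
  have hD : 0 < t ^ 2 + a ^ 2 := by positivity
  set P : ℝ → ℝ := fun x => -((Real.cos (t * x) - 1) * x)
    + t * (x * (a * Real.sin (t * x) + t * Real.cos (t * x)) / (t ^ 2 + a ^ 2)
      + ((a ^ 2 - t ^ 2) * Real.sin (t * x) + 2 * a * t * Real.cos (t * x))
          / (t ^ 2 + a ^ 2) ^ 2) with hP
  set G : ℝ → ℝ := fun x => 2 * a * (P x * Real.exp (-(a * x))) with hG
  have hd : ∀ x ∈ Set.Ici (0:ℝ), HasDerivAt G (auxF t a x) x := by
    intro x _
    have hl : HasDerivAt (fun x : ℝ => t * x) t x := by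
      simpa using (hasDerivAt_id x).const_mul t
    have hc := hl.cos
    have hs := hl.sin
    have hx := hasDerivAt_id' x
    have h1 := ((hc.sub_const 1).mul hx).neg
    have h2 := (hx.mul ((hs.const_mul a).add (hc.const_mul t))).div_const (t ^ 2 + a ^ 2)
    have h3 := ((hs.const_mul (a ^ 2 - t ^ 2)).add (hc.const_mul (2 * a * t))).div_const
      ((t ^ 2 + a ^ 2) ^ 2)
    have h4 := h1.add ((h2.add h3).const_mul t)
    have h5 := (h4.mul (aux_expderiv a x)).const_mul (2 * a)
    refine h5.congr_deriv ?_
    simp only [Pi.add_apply, Pi.mul_apply, Pi.neg_apply, auxF]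
    field_simp
    ring
  have ht : Tendsto G atTop (𝓝 0) := by
    set C : ℝ := 2 + |t| * (a + |t|) / (t ^ 2 + a ^ 2) with hC
    set E : ℝ := |t| * (|a ^ 2 - t ^ 2| + 2 * a * |t|) / (t ^ 2 + a ^ 2) ^ 2 with hE
    have hb := (((aux_tendsto a ha 1).const_mul C).add
      ((aux_tendsto a ha 0).const_mul E)).const_mul (2 * a)
    simp only [mul_zero, add_zero] at hb
    refine squeeze_zero_norm' ?_ hb
    filter_upwards [eventually_gt_atTop 0] with x hx
    have hs := Real.abs_sin_le_one (t * x)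
    have hc := Real.abs_cos_le_one (t * x)
    have hPb : |P x| ≤ C * x + E := by
      have e1 : |(Real.cos (t * x) - 1) * x| ≤ 2 * x := by
        rw [abs_mul, abs_of_pos hx]
        gcongr
        have := abs_le.1 hc
        rw [abs_le]; constructor <;> linarith
      have e2 : |a * Real.sin (t * x) + t * Real.cos (t * x)| ≤ a * 1 + |t| * 1 := by
        refine (abs_add_le _ _).trans ?_
        rw [abs_mul, abs_mul, abs_of_pos ha]
        gcongr
      have e3 : |(a ^ 2 - t ^ 2) * Real.sin (t * x) + 2 * a * t * Real.cos (t * x)|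
          ≤ |a ^ 2 - t ^ 2| * 1 + 2 * a * |t| * 1 := by
        refine (abs_add_le _ _).trans ?_
        rw [abs_mul, abs_mul, abs_mul, abs_of_pos (by positivity : 0 < 2 * a)]
        gcongr
      calc |P x| ≤ 2 * x + |t| * (x * (a * 1 + |t| * 1) / (t ^ 2 + a ^ 2)
            + (|a ^ 2 - t ^ 2| * 1 + 2 * a * |t| * 1) / (t ^ 2 + a ^ 2) ^ 2) := by
            refine (abs_add_le _ _).trans ?_
            rw [abs_neg, abs_mul t]
            gcongr
            refine (abs_add_le _ _).trans ?_
            rw [abs_div, abs_div, abs_mul x, abs_of_pos hx, abs_of_pos hD,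
              abs_of_pos (by positivity : 0 < (t ^ 2 + a ^ 2) ^ 2)]
            gcongr
        _ = C * x + E := by rw [hC, hE]; ring
    rw [hG, Real.norm_eq_abs, abs_mul (2 * a), abs_mul (P x), abs_of_pos (Real.exp_pos _),
      abs_of_pos (by positivity : 0 < 2 * a)]
    calc 2 * a * (|P x| * Real.exp (-(a * x)))
        ≤ 2 * a * ((C * x + E) * Real.exp (-(a * x))) := by gcongr
      _ = _ := by ring
  rw [integral_Ioi_of_hasDerivAt_of_tendsto' hd (auxF_int t a ha) ht]
  simp [hG, hP]
  field_simp
  ring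

lemma HasSum.congr_val {f g : ℕ → ℝ} (a b : ℝ) (h : ∀ n, f n = g n) (hab : a = b)
    (hg : HasSum g b) : HasSum f a := by
  rw [hab, funext h]; exact hg

lemma aux_sum (t x : ℝ) (hx : 0 < x) :
    HasSum (fun n : ℕ => auxF t (π * (n + 1)) x)
      ((Real.cos (t * x) - 1) * (π / 2) * (1 / Real.sinh (π * x / 2)) ^ 2 *
        (π * x * (Real.cosh (π * x / 2) / Real.sinh (π * x / 2)) - 1)) := by
  set r := Real.exp (-(π * x / 2)) with hr
  have hr0 : 0 < r := Real.exp_pos _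
  have hpx : 0 < π * x := mul_pos pi_pos hx
  have hr1 : r < 1 := by rw [hr, Real.exp_lt_one_iff]; linarith
  have hq : ‖r ^ 2‖ < 1 := by
    rw [Real.norm_eq_abs, abs_of_pos (by positivity)]; nlinarith
  have hq' : 0 < 1 - r ^ 2 := by nlinarith
  have s1 := hasSum_choose_mul_geometric_of_norm_lt_one 1 hq
  have s2 := hasSum_choose_mul_geometric_of_norm_lt_one 2 hq
  have hinv : Real.exp (π * x / 2) = r⁻¹ := by rw [hr, Real.exp_neg, inv_inv]
  have hsinh : Real.sinh (π * x / 2) = (1 - r ^ 2) / (2 * r) := by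
    rw [Real.sinh_eq, ← hr, hinv]; field_simp
  have hcosh : Real.cosh (π * x / 2) = (1 + r ^ 2) / (2 * r) := by
    rw [Real.cosh_eq, ← hr, hinv]; field_simp
  have s3 := ((s2.mul_left (2 * π * x)).sub (s1.mul_left (π * x + 1))).mul_left
    ((Real.cos (t * x) - 1) * (2 * π) * r ^ 2)
  refine HasSum.congr_val _ _ ?_ ?_ s3
  · intro n
    have he : Real.exp (-(π * (n + 1) * x)) = r ^ 2 * (r ^ 2) ^ n := by
      rw [← pow_succ', ← pow_mul, hr, ← Real.exp_nat_mul]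
      congr 1; push_cast; ring
    have hch : (((n + 2).choose 2 : ℕ) : ℝ) = (n + 2) * (n + 1) / 2 := by
      rw [Nat.cast_choose_two]; push_cast; ring
    rw [auxF, he, hch, Nat.choose_one_right]
    push_cast
    ring
  · rw [hsinh, hcosh]
    have := hq'.ne'
    field_simp
    ring

lemma aux_summable : Summable (fun n : ℕ => 1 / (π * ((n:ℝ) + 1)) ^ 2) := by
  have h := (summable_nat_add_iff 1).2 (Real.summable_one_div_nat_pow.2 (one_lt_two))
  refine (h.mul_left (1 / π ^ 2)).congr fun n => ?_
  push_cast
  have := pi_pos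
  field_simp

lemma aux_coth (s : ℝ) (hs : s ≠ 0) :
    ∑' n : ℕ, 2 * s ^ 2 / (s ^ 2 + (π * ((n:ℝ) + 1)) ^ 2)
      = s * (Real.cosh s / Real.sinh s) - 1 := by
  have hpi : (π : ℂ) ≠ 0 := by exact_mod_cast pi_ne_zero
  have hsC : (s : ℂ) ≠ 0 := by exact_mod_cast hs
  have hsinh : (Complex.sinh (s:ℂ)) ≠ 0 := by
    rw [← Complex.ofReal_sinh]; exact_mod_cast (Real.sinh_ne_zero.2 hs)
  set z : ℂ := (s / π : ℝ) * Complex.I with hz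
  have him : z.im = s / π := by simp [hz]
  have hzm : z ∈ Complex.integerComplement := by
    rintro ⟨n, hn⟩
    have : z.im = 0 := by rw [← hn]; simp
    rw [him] at this
    exact (div_ne_zero hs pi_ne_zero) this
  have h := cot_series_rep' hzm
  have hpz : (π : ℂ) * z = s * Complex.I := by
    rw [hz]; push_cast; field_simp
  have h1 : (s / π * Complex.I : ℂ) * ((π:ℂ) * Complex.cot (π * z) - 1 / z)
      = ((s * (Real.cosh s / Real.sinh s) - 1 : ℝ) : ℂ) := by
    rw [hpz, Complex.cot, Complex.cos_mul_I, Complex.sin_mul_I, hz]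
    push_cast
    have := Complex.I_ne_zero
    field_simp
  apply Complex.ofReal_injective
  rw [← h1, h, Complex.ofReal_tsum, ← tsum_mul_left]
  congr 1
  ext n
  have n1 : z - (n + 1) ≠ 0 := by
    intro h0
    have := congrArg Complex.im h0
    have h3 : s / π = 0 := by rw [← him]; simpa using this
    exact (div_ne_zero hs pi_ne_zero) h3
  have n2 : z + (n + 1) ≠ 0 := by
    intro h0
    have := congrArg Complex.im h0
    have h3 : s / π = 0 := by rw [← him]; simpa using this
    exact (div_ne_zero hs pi_ne_zero) h3
  have n3 : (s:ℂ) ^ 2 + (π * (n + 1)) ^ 2 ≠ 0 := by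
    have : s ^ 2 + (π * ((n:ℝ) + 1)) ^ 2 ≠ 0 := by positivity
    exact_mod_cast this
  have hzs : (s / π * Complex.I : ℂ) = z := by rw [hz]; push_cast; rfl
  have hz2 : (s:ℂ) ^ 2 = - (π ^ 2 * z ^ 2) := by
    rw [hz]; push_cast; rw [mul_pow, Complex.I_sq]; field_simp
  rw [hzs]
  push_cast
  rw [hz2] at n3 ⊢
  rw [div_add_div _ _ n1 n2, ← mul_div_assoc, div_eq_div_iff n3 (mul_ne_zero n1 n2)]
  ring

lemma aux_tsum (t : ℝ) (ht : t ≠ 0) :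
    ∑' n : ℕ, -(4 * (π * ((n:ℝ) + 1)) ^ 2 * t ^ 2 / (t ^ 2 + (π * ((n:ℝ) + 1)) ^ 2) ^ 2)
      = t ^ 2 * (1 / Real.sinh t) ^ 2 - t * (Real.cosh t / Real.sinh t) := by
  set R := |t| + 1 with hR
  have hsum := aux_summable
  have hR0 : 0 < R := by positivity
  have hder := hasDerivAt_tsum_of_isPreconnected
    (g := fun (n : ℕ) (s : ℝ) => 2 * s ^ 2 / (s ^ 2 + (π * ((n:ℝ) + 1)) ^ 2))
    (g' := fun (n : ℕ) (s : ℝ) =>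
      4 * s * (π * ((n:ℝ) + 1)) ^ 2 / (s ^ 2 + (π * ((n:ℝ) + 1)) ^ 2) ^ 2)
    (u := fun n : ℕ => 4 * R * (1 / (π * ((n:ℝ) + 1)) ^ 2))
    (t := Set.Ioo (-R) R) (y₀ := t) (y := t) (hsum.mul_left _) isOpen_Ioo isPreconnected_Ioo
    (by
      intro n y _
      have hb : y ^ 2 + (π * ((n:ℝ) + 1)) ^ 2 ≠ 0 := by positivity
      have h1 := ((hasDerivAt_pow 2 y).const_mul 2).div
        ((hasDerivAt_pow 2 y).add_const ((π * ((n:ℝ) + 1)) ^ 2)) hb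
      refine h1.congr_deriv ?_
      congr 1
      push_cast
      ring)
    (by
      intro n y hy
      set b := π * ((n:ℝ) + 1) with hb
      have hb0 : 0 < b := by positivity
      have hyR : |y| ≤ R := (abs_lt.2 ⟨hy.1, hy.2⟩).le
      rw [Real.norm_eq_abs, abs_div, abs_mul, abs_mul, abs_of_pos (by positivity : 0 < b ^ 2),
        abs_of_pos (by positivity : 0 < (y ^ 2 + b ^ 2) ^ 2), abs_of_pos (by norm_num : (0:ℝ) < 4)]
      calc 4 * |y| * b ^ 2 / (y ^ 2 + b ^ 2) ^ 2 ≤ 4 * R * b ^ 2 / (b ^ 2) ^ 2 := by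
            gcongr
            nlinarith [sq_nonneg y]
        _ = _ := by field_simp)
    (by constructor <;> cases abs_cases t <;> linarith)
    (by
      refine Summable.of_nonneg_of_le (fun n => by positivity) (fun n => ?_)
        (hsum.mul_left (2 * t ^ 2))
      rw [mul_one_div]
      gcongr
      nlinarith [sq_nonneg t])
    (by constructor <;> cases abs_cases t <;> linarith)
  have hsh : Real.sinh t ≠ 0 := Real.sinh_ne_zero.2 ht
  have hder2 : HasDerivAt (fun s => s * (Real.cosh s / Real.sinh s) - 1)
      (Real.cosh t / Real.sinh t - t * (1 / Real.sinh t) ^ 2) t := by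
    have h1 := ((hasDerivAt_id' t).mul
      ((Real.hasDerivAt_cosh t).div (Real.hasDerivAt_sinh t) hsh)).sub_const 1
    refine h1.congr_deriv ?_
    have := Real.cosh_sq t
    simp only [Pi.div_apply]
    field_simp
    rw [this]
    ring
  have heq := hder.unique (hder2.congr_of_eventuallyEq (by
    filter_upwards [isOpen_ne.mem_nhds ht] with s hs
    exact aux_coth s hs))
  have : t ^ 2 * (1 / Real.sinh t) ^ 2 - t * (Real.cosh t / Real.sinh t)
      = -t * (Real.cosh t / Real.sinh t - t * (1 / Real.sinh t) ^ 2) := by ring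
  rw [this, ← heq, ← tsum_mul_left]
  congr 1
  ext n
  ring

theorem stmt_1 (t : ℝ) :
    ∫ x in Set.Ioi (0:ℝ),
      (Real.cos (t * x) - 1) * (π / 2) * (1 / Real.sinh (π * x / 2)) ^ 2 *
        (π * x * (Real.cosh (π * x / 2) / Real.sinh (π * x / 2)) - 1)
    = if t = 0 then 0 else
        t ^ 2 * (1 / Real.sinh t) ^ 2 - t * (Real.cosh t / Real.sinh t) := by
  split_ifs with ht
  · simp [ht]
  · have hpos : ∀ n : ℕ, 0 < π * ((n:ℝ) + 1) := fun n => by positivity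
    have h := hasSum_integral_of_summable_integral_norm (μ := volume.restrict (Set.Ioi (0:ℝ)))
      (F := fun (n : ℕ) => auxF t (π * ((n:ℝ) + 1)))
      (fun n => auxF_int t _ (hpos n))
      (Summable.of_nonneg_of_le (fun n => integral_nonneg fun x => norm_nonneg _)
        (fun n => auxF_norm t _ (hpos n))
        ((aux_summable.mul_left (8 * t ^ 2)).congr fun n => by rw [mul_one_div]))
    have h2 := h.tsum_eq
    rw [← aux_tsum t ht]
    calc _ = ∫ x in Set.Ioi (0:ℝ), ∑' n : ℕ, auxF t (π * ((n:ℝ) + 1)) x := by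
          refine setIntegral_congr_fun measurableSet_Ioi fun x hx => ?_
          exact (aux_sum t x hx).tsum_eq.symm
      _ = _ := by
          rw [← h2]
          congr 1
          ext n
          exact auxF_val t _ (hpos n)
end

section
/- For all real t, the integral over (0,∞) of (cos(tx) − 1)·(π/2)·cosh(πx/2)/sinh²(πx/2) dx equals −t·tanh(t). -/
open Real MeasureTheory

lemma aux_mem (t : ℝ) (ht : t ≠ 0) :
    ((t / π : ℝ) : ℂ) * Complex.I ∈ Complex.integerComplement := by
  rintro ⟨n, hn⟩
  have := congrArg Complex.im hn
  simp at this
  exact (div_ne_zero ht Real.pi_ne_zero) this.symm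

lemma aux_coth_s4 (t : ℝ) (ht : t ≠ 0) :
    HasSum (fun n : ℕ => 2 * t / (t ^ 2 + ((n : ℝ) + 1) ^ 2 * π ^ 2))
      (Real.cosh t / Real.sinh t - 1 / t) := by
  have hm := aux_mem t ht
  have h1 := (summable_cotTerm hm).hasSum
  have h2 := cot_series_rep' hm
  simp only [cotTerm] at h1
  rw [← h2] at h1
  have h3 := h1.mul_left (Complex.I / π)
  have hpi : (π : ℂ) ≠ 0 := by exact_mod_cast Real.pi_ne_zero
  have htc : (t : ℂ) ≠ 0 := by exact_mod_cast ht
  have hs : Complex.sinh (t : ℂ) ≠ 0 := by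
    rw [← Complex.ofReal_sinh]
    exact_mod_cast (Real.sinh_ne_zero.mpr ht)
  rw [← Complex.hasSum_ofReal]
  have hI2 : Complex.I ^ 2 = -1 := Complex.I_sq
  convert! h3 using 1
  · funext n
    have e := cotTerm_identity hm n
    simp only [cotTerm] at e
    rw [e]
    have hd : ((t : ℂ) ^ 2 + ((n : ℂ) + 1) ^ 2 * (π : ℂ) ^ 2) ≠ 0 := by
      have : t ^ 2 + ((n : ℝ) + 1) ^ 2 * π ^ 2 ≠ 0 := by positivity
      exact_mod_cast this
    have e2 : ((((t / π : ℝ) : ℂ) * Complex.I + (n + 1)) * (((t / π : ℝ) : ℂ) * Complex.I - (n + 1)))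
        = - ((t : ℂ) ^ 2 + ((n : ℂ) + 1) ^ 2 * (π : ℂ) ^ 2) / π ^ 2 := by
      push_cast
      field_simp
      linear_combination (t : ℂ) ^ 2 * hI2
    rw [e2]
    push_cast
    field_simp
    linear_combination hI2
  · have e3 : (π : ℂ) * (((t / π : ℝ) : ℂ) * Complex.I) = t * Complex.I := by
      push_cast
      field_simp
    rw [e3, Complex.cot, Complex.cos_mul_I, Complex.sin_mul_I]
    push_cast
    have := Complex.I_ne_zero
    field_simp

lemma aux_tanh (t : ℝ) (ht : t ≠ 0) :
    HasSum (fun n : ℕ => 2 * t / (t ^ 2 + ((2 * n + 1) * π / 2) ^ 2)) (Real.tanh t) := by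
  have h1 := aux_coth_s4 t ht
  have h2 := (aux_coth_s4 (2 * t) (by simpa using ht)).mul_left 2
  set f : ℕ → ℝ := fun n => 2 * (2 * (2 * t) / ((2 * t) ^ 2 + ((n : ℝ) + 1) ^ 2 * π ^ 2)) with hf
  have hso : (fun k : ℕ => f (2 * k + 1)) = fun n : ℕ => 2 * t / (t ^ 2 + ((n : ℝ) + 1) ^ 2 * π ^ 2) := by
    funext k
    simp only [hf]
    push_cast
    have : t ^ 2 + ((k : ℝ) + 1) ^ 2 * π ^ 2 ≠ 0 := by positivity
    have : (2 * t) ^ 2 + ((2 * k + 1 : ℝ) + 1) ^ 2 * π ^ 2 ≠ 0 := by positivity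
    field_simp
    ring
  have hse : (fun k : ℕ => f (2 * k)) = fun n : ℕ => 2 * t / (t ^ 2 + ((2 * n + 1) * π / 2) ^ 2) := by
    funext k
    simp only [hf]
    push_cast
    have : t ^ 2 + ((2 * k + 1) * π / 2) ^ 2 ≠ 0 := by positivity
    have : (2 * t) ^ 2 + ((2 * k : ℝ) + 1) ^ 2 * π ^ 2 ≠ 0 := by positivity
    have : t ^ 2 * 2 ^ 2 + ((2 * k + 1) * π) ^ 2 ≠ 0 := by positivity
    field_simp
  have hS : Summable (fun k : ℕ => f (2 * k)) :=
    h2.summable.comp_injective (fun a b h => by simpa using h)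
  rw [← hso] at h1
  have h3 := (hS.hasSum.even_add_odd h1).unique h2
  have hsum := hS.hasSum
  rw [hse] at hsum
  convert! hsum using 1
  rw [hse] at h3
  rw [eq_sub_of_add_eq h3, Real.tanh_eq_sinh_div_cosh, Real.cosh_two_mul, Real.sinh_two_mul]
  have := Real.sinh_ne_zero.mpr ht
  have := (Real.cosh_pos t).ne'
  field_simp
  ring

lemma aux_int (t a : ℝ) (ha : 0 < a) :
    IntegrableOn (fun x => (1 - Real.cos (t * x)) * Real.exp (-(a * x))) (Set.Ioi 0) ∧
    ∫ x in Set.Ioi (0:ℝ), (1 - Real.cos (t * x)) * Real.exp (-(a * x))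
      = t ^ 2 / (a * (a ^ 2 + t ^ 2)) := by
  have hd : a ^ 2 + t ^ 2 ≠ 0 := by positivity
  set g : ℝ → ℝ := fun x => Real.exp (-(a * x)) *
    (-(1 / a) - (t * Real.sin (t * x) - a * Real.cos (t * x)) / (a ^ 2 + t ^ 2)) with hg
  have hderiv : ∀ x ∈ Set.Ici (0:ℝ),
      HasDerivAt g ((1 - Real.cos (t * x)) * Real.exp (-(a * x))) x := by
    intro x _
    have e1 : HasDerivAt (fun x : ℝ => t * x) t x := by simpa using (hasDerivAt_id x).const_mul t
    have e2 : HasDerivAt (fun x : ℝ => -(a * x)) (-a) x := by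
      simpa using (hasDerivAt_id x).const_mul (-a)
    have e3 := e2.exp.mul
      ((((e1.sin.const_mul t).sub (e1.cos.const_mul a)).div_const (a ^ 2 + t ^ 2)).const_sub (-(1 / a)))
    convert! e3 using 1
    simp only [Pi.sub_apply]
    field_simp
    ring
  have hpos : ∀ x ∈ Set.Ioi (0:ℝ), 0 ≤ (1 - Real.cos (t * x)) * Real.exp (-(a * x)) :=
    fun x _ => mul_nonneg (by linarith [Real.cos_le_one (t * x)]) (Real.exp_pos _).le
  have hlim : Filter.Tendsto g Filter.atTop (nhds 0) := by
    have e0 : Filter.Tendsto (fun x : ℝ => Real.exp (-(a * x))) Filter.atTop (nhds 0) :=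
      Real.tendsto_exp_neg_atTop_nhds_zero.comp (Filter.tendsto_id.const_mul_atTop ha)
    refine e0.zero_mul_isBoundedUnder_le ?_
    refine Filter.isBoundedUnder_of ⟨1 / a + (|t| + a) / (a ^ 2 + t ^ 2), fun x => ?_⟩
    simp only [Function.comp, Real.norm_eq_abs]
    refine (abs_sub _ _).trans ?_
    rw [abs_neg, abs_of_pos (by positivity : 0 < 1 / a), abs_div,
      abs_of_pos (by positivity : 0 < a ^ 2 + t ^ 2)]
    gcongr
    refine (abs_sub _ _).trans ?_
    rw [abs_mul, abs_mul, abs_of_pos ha]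
    have := Real.abs_sin_le_one (t * x)
    have := Real.abs_cos_le_one (t * x)
    have := abs_nonneg t
    nlinarith
  refine ⟨integrableOn_Ioi_deriv_of_nonneg' hderiv hpos hlim, ?_⟩
  rw [integral_Ioi_of_hasDerivAt_of_nonneg' hderiv hpos hlim]
  simp [hg]
  field_simp
  ring

lemma aux_series (x : ℝ) (hx : 0 < x) :
    HasSum (fun n : ℕ => 2 * ((2 * n + 1) * π / 2) * Real.exp (-((2 * n + 1) * π / 2 * x)))
      ((π / 2) * (Real.cosh (π * x / 2) / Real.sinh (π * x / 2) ^ 2)) := by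
  set r := Real.exp (-(π * x / 2)) with hr
  have hr0 : 0 < r := Real.exp_pos _
  have hr1 : r < 1 := by
    rw [hr, Real.exp_lt_one_iff]
    have := Real.pi_pos
    have : 0 < π * x / 2 := by positivity
    linarith
  have hq : r ^ 2 < 1 := by nlinarith
  have hqn : ‖r ^ 2‖ < 1 := by rwa [Real.norm_of_nonneg (by positivity)]
  have h := (((hasSum_coe_mul_geometric_of_norm_lt_one hqn).mul_left 2).add
    (hasSum_geometric_of_norm_lt_one hqn)).mul_left (π * r)
  convert! h using 1
  · funext n
    have : Real.exp (-((2 * n + 1) * π / 2 * x)) = r * (r ^ 2) ^ n := by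
      rw [hr, ← pow_mul, ← pow_succ', ← Real.exp_nat_mul]
      congr 1
      push_cast
      ring
    rw [this]
    ring
  · have hri : Real.exp (π * x / 2) = r⁻¹ := by rw [hr, Real.exp_neg, inv_inv]
    rw [Real.cosh_eq, Real.sinh_eq, ← hr, hri]
    have h1 : 1 - r ^ 2 ≠ 0 := by linarith
    have h2 : (r⁻¹ - r) / 2 = (1 - r ^ 2) / (2 * r) := by field_simp
    rw [h2]
    field_simp
    ring

theorem stmt_4 (t : ℝ) :
    ∫ x in Set.Ioi (0:ℝ),
      (Real.cos (t * x) - 1) * (π / 2) * (Real.cosh (π * x / 2) / Real.sinh (π * x / 2) ^ 2)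
    = -t * Real.tanh t := by
  rcases eq_or_ne t 0 with rfl | ht
  · simp
  set a : ℕ → ℝ := fun n => (2 * n + 1) * π / 2 with ha
  have hapos : ∀ n, 0 < a n := fun n => by simp only [ha]; positivity
  set F : ℕ → ℝ → ℝ := fun n x => 2 * a n * ((1 - Real.cos (t * x)) * Real.exp (-(a n * x))) with hF
  have hFi : ∀ n, ∫ x in Set.Ioi (0:ℝ), F n x = t * (2 * t / (t ^ 2 + a n ^ 2)) := by
    intro n
    simp only [hF]
    rw [integral_const_mul, (aux_int t (a n) (hapos n)).2]
    have := (hapos n).ne'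
    have : a n ^ 2 + t ^ 2 ≠ 0 := by positivity
    have : t ^ 2 + a n ^ 2 ≠ 0 := by positivity
    field_simp
    ring
  have hnn : ∀ n x, ‖F n x‖ = F n x := by
    intro n x
    apply Real.norm_of_nonneg
    have := hapos n
    have : 0 ≤ 1 - Real.cos (t * x) := by linarith [Real.cos_le_one (t * x)]
    simp only [hF]
    positivity
  have hT := (aux_tanh t ht).mul_left t
  have hsum := hasSum_integral_of_summable_integral_norm (μ := volume.restrict (Set.Ioi (0:ℝ)))
    (F := F) (fun n => ((aux_int t (a n) (hapos n)).1.integrable).const_mul _)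
    (by simp only [hnn, hFi]; exact hT.summable)
  simp only [hFi] at hsum
  have key := hsum.unique hT
  rw [neg_mul, ← key, ← integral_neg]
  refine setIntegral_congr_fun measurableSet_Ioi fun x hx => ?_
  have hs := (aux_series x hx).mul_left (1 - Real.cos (t * x))
  have : ∑' n, F n x = (1 - Real.cos (t * x)) *
      ((π / 2) * (Real.cosh (π * x / 2) / Real.sinh (π * x / 2) ^ 2)) := by
    rw [← hs.tsum_eq]
    refine tsum_congr fun n => ?_
    simp only [hF, ha]
    ring
  simp only [this]
  ring
end

section
/- For all real t, the integral over (0,∞) of (cos(tx) − 1)·(π/4)·csch(πx/2)·[πx·coth²(πx/2) − 2·coth(πx/2) + πx·csch²(πx/2)] dx equals −t·tanh(t) − t²·sech²(t). -/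
open Real MeasureTheory

lemma hasSum_transfer {E : Type*} [AddCommMonoid E] [TopologicalSpace E] {f g : ℕ → E} {a b : E}
    (h : HasSum f a) (hf : ∀ n, g n = f n) (hab : b = a) : HasSum g b := by
  rw [show g = f from funext hf, hab]; exact h

lemma coth_hasSum (s : ℝ) (hs : s ≠ 0) :
    HasSum (fun n : ℕ => 1 / (s ^ 2 + (n:ℝ) ^ 2))
      ((π * (Real.cosh (π * s) / Real.sinh (π * s)) + 1 / s) / (2 * s)) := by
  have hz : (Complex.I * s : ℂ) ∈ Complex.integerComplement := by
    rintro ⟨n, hn⟩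
    have := congrArg Complex.im hn
    simp at this
    exact hs this.symm
  have h1 := (summable_cotTerm hz).hasSum
  have h2 := cot_series_rep' hz
  have hsC : (s : ℂ) ≠ 0 := by exact_mod_cast hs
  have h3 : ∑' n, cotTerm (Complex.I * s) n = π * Complex.cot (π * (Complex.I * s)) - 1 / (Complex.I * s) := by
    rw [h2]
  rw [h3] at h1
  have h4 := h1.mul_left (Complex.I / (2 * s))
  have hsh : Real.sinh (π * s) ≠ 0 := by
    rw [Ne, Real.sinh_eq_zero]; positivity
  have hshC : Complex.sinh (π * s) ≠ 0 := by exact_mod_cast hsh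
  have h5 : HasSum (fun n : ℕ => (((1 / (s ^ 2 + ((n + 1 : ℕ):ℝ) ^ 2) : ℝ)) : ℂ))
      (((π * (Real.cosh (π * s) / Real.sinh (π * s)) - 1 / s) / (2 * s) : ℝ) : ℂ) := by
    refine hasSum_transfer h4 ?_ ?_
    · intro n
      have e1 : ((s:ℂ) ^ 2 + ((n:ℂ) + 1) ^ 2) ≠ (0:ℂ) := by
        have : (s ^ 2 + ((n:ℝ) + 1) ^ 2) ≠ 0 := by positivity
        exact_mod_cast this
      have e2 : (Complex.I * s - ((n:ℂ) + 1)) * (Complex.I * s + ((n:ℂ) + 1)) = -((s:ℂ) ^ 2 + ((n:ℂ) + 1) ^ 2) := by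
        linear_combination (s:ℂ) ^ 2 * Complex.I_sq
      have e3 : (Complex.I * s - ((n:ℂ) + 1)) ≠ 0 := by
        intro h; rw [h] at e2; simp at e2; apply e1; linear_combination e2
      have e4 : (Complex.I * s + ((n:ℂ) + 1)) ≠ 0 := by
        intro h; rw [h] at e2; simp at e2; apply e1; linear_combination e2
      rw [show cotTerm (Complex.I * s) n = 1 / (Complex.I * s - (n + 1)) + 1 / (Complex.I * s + (n + 1)) from rfl]
      push_cast
      rw [div_add_div _ _ e3 e4, e2]
      field_simp
      linear_combination (2 * (s:ℂ)) * Complex.I_sq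
    · rw [show (π * (Complex.I * s) : ℂ) = (π * s) * Complex.I by ring, Complex.cot, Complex.cos_mul_I,
        Complex.sin_mul_I]
      push_cast
      field_simp
      try linear_combination (0:ℂ)
  have h6 := Complex.hasSum_ofReal.1 h5
  rw [← hasSum_nat_add_iff' 1]
  refine hasSum_transfer h6 (fun n => rfl) ?_
  simp
  field_simp
  ring

lemma tanh_hasSum (t : ℝ) (ht : t ≠ 0) :
    HasSum (fun n : ℕ => 2 * t / (t ^ 2 + ((2 * n + 1) * (π / 2)) ^ 2)) (Real.tanh t) := by
  have hp := Real.pi_ne_zero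
  have h1 := coth_hasSum (t / π) (by positivity)
  have h2 := coth_hasSum (2 * t / π) (by positivity)
  rw [show π * (t / π) = t by field_simp] at h1
  rw [show π * (2 * t / π) = 2 * t by field_simp] at h2
  have hinj : Function.Injective (fun n : ℕ => 2 * n + 1) := fun a b h => by
    simp only at h; omega
  have hs : Summable (fun n : ℕ => 1 / ((2 * t / π) ^ 2 + ((2 * n + 1 : ℕ):ℝ) ^ 2)) := by
    have := h2.summable.comp_injective hinj
    simpa only [Function.comp_def] using this
  have he : HasSum (fun n : ℕ => 1 / ((2 * t / π) ^ 2 + ((2 * n : ℕ):ℝ) ^ 2)) (1 / 4 * ((π * (cosh t / sinh t) + 1 / (t / π)) / (2 * (t / π)))) := by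
    refine hasSum_transfer (h1.mul_left (1 / 4)) ?_ rfl
    intro n
    push_cast
    field_simp
    ring
  have h3 := (HasSum.even_add_odd (f := fun n : ℕ => 1 / ((2 * t / π) ^ 2 + (n:ℝ) ^ 2)) he hs.hasSum).unique h2
  have h4 := hs.hasSum.mul_left (8 * t / π ^ 2)
  refine hasSum_transfer h4 ?_ ?_
  · intro n
    push_cast
    field_simp
    ring
  · rw [eq_sub_of_add_eq' h3, Real.tanh_eq_sinh_div_cosh, Real.sinh_two_mul, Real.cosh_two_mul]
    have : Real.sinh t ≠ 0 := by rwa [Ne, Real.sinh_eq_zero]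
    have := (Real.cosh_pos t).ne'
    field_simp
    ring

lemma sin_exp_integral (t a : ℝ) (ha : 0 < a) :
    IntegrableOn (fun x => Real.sin (t * x) * Real.exp (-a * x)) (Set.Ioi 0) ∧
    ∫ x in Set.Ioi (0:ℝ), Real.sin (t * x) * Real.exp (-a * x) = t / (t ^ 2 + a ^ 2) := by
  have hre : ((-a : ℝ) + t * Complex.I : ℂ).re < 0 := by simpa using ha
  have h1 := integral_exp_mul_complex_Ioi hre 0
  have h2 := integrableOn_exp_mul_complex_Ioi hre 0
  have him : ∀ x : ℝ, RCLike.im (Complex.exp (((-a : ℝ) + t * Complex.I : ℂ) * x))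
      = Real.sin (t * x) * Real.exp (-a * x) := by
    intro x
    rw [RCLike.im_to_complex, Complex.exp_im]
    simp
    ring
  constructor
  · have := h2.im
    simp only [him] at this
    exact this
  · have h3 := integral_im h2
    simp only [him] at h3
    rw [h3, h1, RCLike.im_to_complex]
    simp [Complex.div_im, Complex.normSq_apply]
    ring

lemma csch_series (u : ℝ) (hu : 0 < u) :
    HasSum (fun n : ℕ => 2 * Real.exp (-((2 * n + 1) * u))) (1 / Real.sinh u) := by
  have h1 : Real.exp (-2 * u) < 1 := by rw [Real.exp_lt_one_iff]; linarith
  have h2 := (hasSum_geometric_of_lt_one (Real.exp_pos (-2 * u)).le h1).mul_left (2 * Real.exp (-u))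
  refine hasSum_transfer h2 ?_ ?_
  · intro n
    rw [← Real.exp_nat_mul, mul_assoc, ← Real.exp_add]
    ring_nf
  · have h3 : 1 - Real.exp (-2 * u) ≠ 0 := by linarith
    have h4 : Real.sinh u = Real.exp u * (1 - Real.exp (-2 * u)) / 2 := by
      rw [Real.sinh_eq, mul_sub, ← Real.exp_add]
      ring_nf
    rw [h4, Real.exp_neg]
    have := Real.exp_pos u
    field_simp

lemma sin_csch_integral (t : ℝ) :
    ∫ x in Set.Ioi (0:ℝ), Real.sin (t * x) * (1 / Real.sinh (π * x / 2)) = Real.tanh t := by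
  rcases eq_or_ne t 0 with rfl | ht
  · simp
  have ha : ∀ n : ℕ, 0 < (2 * (n:ℝ) + 1) * (π / 2) := fun n => by positivity
  have key := hasSum_integral_of_summable_integral_norm (μ := volume.restrict (Set.Ioi (0:ℝ)))
    (F := fun (n : ℕ) (x : ℝ) => 2 * (Real.sin (t * x) * Real.exp (-((2 * n + 1) * (π / 2)) * x)))
    (fun n => (sin_exp_integral t _ (ha n)).1.const_mul 2) ?_
  · have h1 : HasSum (fun n : ℕ => ∫ x in Set.Ioi (0:ℝ),
        2 * (Real.sin (t * x) * Real.exp (-((2 * n + 1) * (π / 2)) * x))) (Real.tanh t) := by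
      refine hasSum_transfer (tanh_hasSum t ht) ?_ rfl
      intro n
      rw [integral_const_mul, (sin_exp_integral t _ (ha n)).2]
      ring
    rw [← key.unique h1]
    refine setIntegral_congr_fun measurableSet_Ioi fun x hx => ?_
    have hx' : (0:ℝ) < x := hx
    have h2 := (csch_series (π * x / 2) (by positivity)).mul_left (Real.sin (t * x))
    rw [← h2.tsum_eq]
    refine tsum_congr fun n => ?_
    ring_nf
  · have hsum : Summable (fun n : ℕ => 2 * |t| * (1 / ((2 * (n:ℝ) + 1) * (π / 2)) ^ 2)) := by
      have hinj : Function.Injective (fun n : ℕ => 2 * n + 1) := fun a b h => by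
        simp only at h; omega
      have h0 := (Real.summable_one_div_nat_pow (p := 2)).2 (by norm_num)
      have h1 := (h0.comp_injective hinj).mul_left (2 * |t| * (1 / (π / 2) ^ 2))
      refine h1.congr fun n => ?_
      simp only [Function.comp_def]
      push_cast
      field_simp
    refine Summable.of_nonneg_of_le (fun n => by positivity) (fun n => ?_) hsum
    have e1 := Real.integral_rpow_mul_exp_neg_mul_Ioi (a := 2) (by norm_num) (ha n)
    have hg : Real.Gamma 2 = 1 := Real.Gamma_two
    rw [hg, mul_one] at e1
    norm_num at e1
    have e2 : IntegrableOn (fun x : ℝ => x * Real.exp (-((2 * (n:ℝ) + 1) * (π / 2) * x))) (Set.Ioi 0) := by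
      by_contra hc
      have := integral_undef hc
      rw [this] at e1
      have := ha n
      have : (0:ℝ) < ((2 * (n:ℝ) + 1) * (π / 2)) ^ 2 := by positivity
      field_simp at e1
      try norm_num at e1
    calc _ ≤ ∫ x in Set.Ioi (0:ℝ), 2 * |t| * (x * Real.exp (-((2 * (n:ℝ) + 1) * (π / 2) * x))) := by
          refine setIntegral_mono_on ((sin_exp_integral t _ (ha n)).1.const_mul 2).norm (e2.const_mul _) measurableSet_Ioi ?_
          intro x hx
          have hx' : (0:ℝ) < x := hx
          have : |Real.sin (t * x)| ≤ |t| * x := by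
            refine (Real.abs_sin_le_abs).trans ?_
            rw [abs_mul, abs_of_pos hx']
          rw [Real.norm_eq_abs, abs_mul, abs_mul, abs_of_pos (Real.exp_pos _), abs_two, neg_mul]
          have := mul_le_mul_of_nonneg_right this (Real.exp_pos (-((2 * (n:ℝ) + 1) * (π / 2) * x))).le
          linarith
      _ = _ := by
          rw [integral_const_mul, e1]
          field_simp

lemma csch_bd (u : ℝ) (hu : 0 < u) :
    0 < u / Real.sinh u ∧ u / Real.sinh u ≤ 1 ∧ u * (Real.cosh u / Real.sinh u) ≤ 1 + u ∧
    0 < u * (Real.cosh u / Real.sinh u) ∧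
    u / Real.sinh u * (1 + u) ^ 3 ≤ 8192 * Real.exp (-(u / 2)) := by
  have hs : 0 < Real.sinh u := Real.sinh_pos_iff.2 hu
  have hc : 0 < Real.cosh u := Real.cosh_pos u
  have hus : u ≤ Real.sinh u := Real.self_le_sinh_iff.2 hu.le
  have he : Real.exp (-u) ≤ 1 := Real.exp_le_one_iff.2 (by linarith)
  have he0 := Real.exp_pos (-u)
  refine ⟨by positivity, (div_le_one hs).2 hus, ?_, by positivity, ?_⟩
  · rw [← mul_div_assoc, div_le_iff₀ hs]
    have : Real.cosh u = Real.sinh u + Real.exp (-u) := by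
      rw [← Real.cosh_sub_sinh]; ring
    rw [this]
    nlinarith
  · have h1 : u / Real.sinh u ≤ 2 * (1 + u) * Real.exp (-u) := by
      rw [div_le_iff₀ hs, Real.sinh_eq]
      have e1 : Real.exp (-u) * Real.exp u = 1 := by rw [← Real.exp_add]; simp
      have e2 : Real.exp (-u) * Real.exp (-u) = Real.exp (-(2 * u)) := by rw [← Real.exp_add]; ring_nf
      have e3 : Real.exp (-(2 * u)) * (1 + 2 * u) ≤ 1 := by
        have := Real.add_one_le_exp (2 * u)
        have e4 : Real.exp (-(2 * u)) * Real.exp (2 * u) = 1 := by rw [← Real.exp_add]; simp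
        have := mul_le_mul_of_nonneg_left this (Real.exp_pos (-(2 * u))).le
        linarith
      have e5 : 2 * (1 + u) * Real.exp (-u) * ((Real.exp u - Real.exp (-u)) / 2)
          = (1 + u) * (1 - Real.exp (-(2 * u))) := by
        rw [← e2, ← e1]; ring
      rw [e5]
      nlinarith [Real.exp_pos (-(2 * u))]
    have h2 : 1 + u ≤ 8 * Real.exp (u / 8) := by
      have := Real.add_one_le_exp (u / 8)
      linarith
    have h3 : (1 + u) ^ 4 ≤ 4096 * Real.exp (u / 2) := by
      calc (1 + u) ^ 4 ≤ (8 * Real.exp (u / 8)) ^ 4 := by gcongr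
        _ = _ := by
          rw [mul_pow, ← Real.exp_nat_mul]; norm_num; ring_nf
    calc u / Real.sinh u * (1 + u) ^ 3 ≤ 2 * (1 + u) * Real.exp (-u) * (1 + u) ^ 3 := by gcongr
      _ = 2 * Real.exp (-u) * (1 + u) ^ 4 := by ring
      _ ≤ 2 * Real.exp (-u) * (4096 * Real.exp (u / 2)) := by gcongr
      _ = 8192 * (Real.exp (-u) * Real.exp (u / 2)) := by ring
      _ = _ := by rw [← Real.exp_add]; ring_nf

lemma q_bd (u : ℝ) (hu : 0 < u) : u / Real.sinh u ≤ 8192 * Real.exp (-(u / 2)) := by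
  obtain ⟨h0, -, -, -, h5⟩ := csch_bd u hu
  refine le_trans ?_ h5
  have : 1 ≤ (1 + u) ^ 3 := one_le_pow₀ (by linarith)
  nlinarith

lemma bracket_bd (u : ℝ) (hu : 0 < u) :
    |u ^ 2 * ((1 / Real.sinh u) * (2 * u * (Real.cosh u / Real.sinh u) ^ 2
      - 2 * (Real.cosh u / Real.sinh u) + 2 * u * (1 / Real.sinh u) ^ 2))| ≤
      6 * 8192 * Real.exp (-(u / 2)) := by
  obtain ⟨h0, h1, h2, h3, h5⟩ := csch_bd u hu
  have hs : 0 < Real.sinh u := Real.sinh_pos_iff.2 hu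
  have e : u ^ 2 * ((1 / Real.sinh u) * (2 * u * (Real.cosh u / Real.sinh u) ^ 2
      - 2 * (Real.cosh u / Real.sinh u) + 2 * u * (1 / Real.sinh u) ^ 2))
      = u / Real.sinh u * (2 * (u * (Real.cosh u / Real.sinh u)) ^ 2
        - 2 * (u * (Real.cosh u / Real.sinh u)) + 2 * (u / Real.sinh u) ^ 2) := by
    field_simp
  rw [e]
  generalize u / Real.sinh u = q at *
  generalize u * (Real.cosh u / Real.sinh u) = p at *
  rw [abs_mul, abs_of_pos h0]
  have hp : p ^ 2 ≤ (1 + u) ^ 2 := by gcongr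
  have hq : q ^ 2 ≤ 1 := pow_le_one₀ h0.le h1
  have : |2 * p ^ 2 - 2 * p + 2 * q ^ 2| ≤ 6 * (1 + u) ^ 3 := by
    rw [abs_le]
    constructor <;> nlinarith [sq_nonneg p, sq_nonneg q, pow_pos hu 3, pow_pos hu 2]
  calc q * |2 * p ^ 2 - 2 * p + 2 * q ^ 2| ≤ q * (6 * (1 + u) ^ 3) := by gcongr
    _ ≤ _ := by linarith

lemma exp_int : IntegrableOn (fun x : ℝ => Real.exp (-(π * x / 2 / 2))) (Set.Ioi 0) := by
  have := exp_neg_integrableOn_Ioi 0 (b := π / 4) (by positivity)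
  refine this.congr_fun (fun x _ => ?_) measurableSet_Ioi
  simp only
  ring_nf

lemma xcsch_bd (x : ℝ) (hx : 0 < x) :
    0 < x * (1 / Real.sinh (π * x / 2)) ∧
    x * (1 / Real.sinh (π * x / 2)) ≤ 8192 * Real.exp (-(π * x / 2 / 2)) := by
  have hu : 0 < π * x / 2 := by positivity
  have h1 := q_bd _ hu
  have hs : 0 < Real.sinh (π * x / 2) := Real.sinh_pos_iff.2 hu
  refine ⟨by positivity, le_trans ?_ h1⟩
  rw [mul_one_div]
  gcongr
  nlinarith [Real.pi_gt_three]

lemma sin_csch_integrable (t : ℝ) :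
    IntegrableOn (fun x => Real.sin (t * x) * (1 / Real.sinh (π * x / 2))) (Set.Ioi 0) := by
  refine Integrable.mono' (exp_int.const_mul (|t| * 8192)) (by
    apply Measurable.aestronglyMeasurable; fun_prop) ?_
  refine (ae_restrict_iff' measurableSet_Ioi).2 (Filter.Eventually.of_forall fun x hx => ?_)
  have hx' : (0:ℝ) < x := hx
  obtain ⟨h1, h2⟩ := xcsch_bd x hx'
  have hs : 0 < Real.sinh (π * x / 2) := Real.sinh_pos_iff.2 (by positivity)
  have : |Real.sin (t * x)| ≤ |t| * x := by
    refine (Real.abs_sin_le_abs).trans ?_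
    rw [abs_mul, abs_of_pos hx']
  rw [Real.norm_eq_abs, abs_mul, abs_of_pos (a := 1 / _) (by positivity)]
  calc _ ≤ |t| * x * (1 / Real.sinh (π * x / 2)) := by gcongr
    _ = |t| * (x * (1 / Real.sinh (π * x / 2))) := by ring
    _ ≤ |t| * (8192 * Real.exp (-(π * x / 2 / 2))) := by gcongr
    _ = _ := by ring

lemma cos_csch_integral (t : ℝ) :
    IntegrableOn (fun x => x * Real.cos (t * x) * (1 / Real.sinh (π * x / 2))) (Set.Ioi 0) ∧
    ∫ x in Set.Ioi (0:ℝ), x * Real.cos (t * x) * (1 / Real.sinh (π * x / 2))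
      = (1 / Real.cosh t) ^ 2 := by
  have key := hasDerivAt_integral_of_dominated_loc_of_deriv_le
    (μ := volume.restrict (Set.Ioi (0:ℝ))) (s := Set.univ) (x₀ := t)
    (F := fun (t x : ℝ) => Real.sin (t * x) * (1 / Real.sinh (π * x / 2)))
    (F' := fun (t x : ℝ) => x * Real.cos (t * x) * (1 / Real.sinh (π * x / 2)))
    (bound := fun x => 8192 * Real.exp (-(π * x / 2 / 2))) Filter.univ_mem
    (Filter.Eventually.of_forall fun t => (sin_csch_integrable t).aestronglyMeasurable)
    (sin_csch_integrable t) (by apply Measurable.aestronglyMeasurable; fun_prop)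
    ?_ (exp_int.const_mul _) ?_
  · refine ⟨key.1, ?_⟩
    have h1 := key.2
    simp only [sin_csch_integral] at h1
    refine h1.unique ?_
    have hc := (Real.cosh_pos t).ne'
    have h2 := (Real.hasDerivAt_sinh t).div (Real.hasDerivAt_cosh t) hc
    have h3 : Real.tanh = fun x => Real.sinh x / Real.cosh x := by
      ext x; exact Real.tanh_eq_sinh_div_cosh x
    have h4 : (1 / Real.cosh t) ^ 2 =
        (Real.cosh t * Real.cosh t - Real.sinh t * Real.sinh t) / Real.cosh t ^ 2 := by
      rw [div_pow, one_pow]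
      congr 1
      nlinarith [Real.cosh_sq t]
    rw [h4]
    show HasDerivAt Real.tanh _ t
    rw [h3]
    exact h2
  · refine (ae_restrict_iff' measurableSet_Ioi).2 (Filter.Eventually.of_forall fun x hx s _ => ?_)
    obtain ⟨h1, h2⟩ := xcsch_bd x hx
    rw [mul_right_comm, Real.norm_eq_abs, abs_mul, abs_of_pos h1]
    refine le_trans ?_ h2
    exact mul_le_of_le_one_right h1.le (Real.abs_cos_le_one _)
  · refine Filter.Eventually.of_forall fun x s _ => ?_
    have h1 : HasDerivAt (fun s : ℝ => Real.sin (s * x)) (Real.cos (s * x) * (1 * x)) s :=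
      ((hasDerivAt_id s).mul_const x).sin
    have h2 := h1.mul_const (1 / Real.sinh (π * x / 2))
    refine h2.congr_deriv ?_
    ring

lemma main_integrable (t : ℝ) : IntegrableOn (fun x =>
      (Real.cos (t * x) - 1) * (π / 4) * (1 / Real.sinh (π * x / 2)) *
        (π * x * (Real.cosh (π * x / 2) / Real.sinh (π * x / 2)) ^ 2
          - 2 * (Real.cosh (π * x / 2) / Real.sinh (π * x / 2))
          + π * x * (1 / Real.sinh (π * x / 2)) ^ 2)) (Set.Ioi (0:ℝ)) := by
  refine Integrable.mono' (exp_int.const_mul (t ^ 2 * 6 * 8192)) (by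
    apply Measurable.aestronglyMeasurable; fun_prop) ?_
  refine (ae_restrict_iff' measurableSet_Ioi).2 (Filter.Eventually.of_forall fun x hx => ?_)
  have hx' : (0:ℝ) < x := hx
  have hb := bracket_bd (π * x / 2) (by positivity)
  rw [show 2 * (π * x / 2) = π * x by ring] at hb
  rw [Real.norm_eq_abs, mul_assoc]
  generalize 1 / Real.sinh (π * x / 2) * (π * x * (Real.cosh (π * x / 2) / Real.sinh (π * x / 2)) ^ 2
          - 2 * (Real.cosh (π * x / 2) / Real.sinh (π * x / 2))
          + π * x * (1 / Real.sinh (π * x / 2)) ^ 2) = B at *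
  have hc : |Real.cos (t * x) - 1| ≤ (t * x) ^ 2 / 2 := by
    rw [abs_le]
    constructor
    · linarith [Real.one_sub_sq_div_two_le_cos (x := t * x)]
    · nlinarith [Real.cos_le_one (t * x), sq_nonneg (t * x)]
  rw [abs_mul, abs_of_nonneg (by positivity)] at hb
  rw [abs_mul, abs_mul, abs_of_pos (a := π / 4) (by positivity)]
  calc |Real.cos (t * x) - 1| * (π / 4) * |B| ≤ (t * x) ^ 2 / 2 * (π / 4) * |B| := by gcongr
    _ = t ^ 2 * (1 / (2 * π)) * ((π * x / 2) ^ 2 * |B|) := by field_simp; try ring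
    _ ≤ t ^ 2 * 1 * (6 * 8192 * Real.exp (-(π * x / 2 / 2))) := by
      gcongr
      rw [div_le_one (by positivity)]
      linarith [Real.pi_gt_three]
    _ = _ := by ring

noncomputable def FF (t x : ℝ) : ℝ :=
  -(Real.cos (t * x) - 1) * (x * (π / 2 * (Real.cosh (π * x / 2) / Real.sinh (π * x / 2) ^ 2)))
    + t * x * Real.sin (t * x) * (1 / Real.sinh (π * x / 2))

lemma FF_bd (t x : ℝ) (hx : 0 ≤ x) :
    |FF t x| ≤ t ^ 2 * 2 * 8192 * (x * Real.exp (-(π * x / 2 / 2))) := by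
  rcases hx.eq_or_lt with rfl | hx
  · simp [FF]
  have hu : 0 < π * x / 2 := by positivity
  obtain ⟨h0, h1, h2, h3, h5⟩ := csch_bd _ hu
  have hs : 0 < Real.sinh (π * x / 2) := Real.sinh_pos_iff.2 hu
  have e : FF t x = -(Real.cos (t * x) - 1) * ((1 / x) * (2 / π) * ((π * x / 2) / Real.sinh (π * x / 2) * ((π * x / 2) * (Real.cosh (π * x / 2) / Real.sinh (π * x / 2)))))
    + t * Real.sin (t * x) * (2 / π) * ((π * x / 2) / Real.sinh (π * x / 2)) := by
    rw [FF]; field_simp; try ring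
  rw [e]
  have hx3 : 1 + π * x / 2 ≤ (1 + π * x / 2) ^ 3 := le_self_pow₀ (by linarith) (by norm_num)
  have hx4 : 1 ≤ (1 + π * x / 2) ^ 3 := one_le_pow₀ (by linarith)
  generalize (π * x / 2) / Real.sinh (π * x / 2) = q at *
  generalize (π * x / 2) * (Real.cosh (π * x / 2) / Real.sinh (π * x / 2)) = p at *
  have hc : |-(Real.cos (t * x) - 1)| ≤ (t * x) ^ 2 / 2 := by
    rw [abs_neg, abs_le]
    constructor
    · linarith [Real.one_sub_sq_div_two_le_cos (x := t * x)]
    · nlinarith [Real.cos_le_one (t * x), sq_nonneg (t * x)]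
  have hsn : |t * Real.sin (t * x)| ≤ t ^ 2 * x := by
    rw [abs_mul]
    calc |t| * |Real.sin (t * x)| ≤ |t| * |t * x| := by
          exact mul_le_mul_of_nonneg_left Real.abs_sin_le_abs (abs_nonneg t)
      _ = t ^ 2 * x := by rw [abs_mul, abs_of_pos hx, ← sq_abs t]; ring
  have hpi : 2 / π ≤ 1 := by
    rw [div_le_one (by positivity)]; linarith [Real.pi_gt_three]
  have hqp : q * p ≤ 8192 * Real.exp (-(π * x / 2 / 2)) := by
    refine le_trans ?_ h5
    gcongr
    linarith
  have hq : q ≤ 8192 * Real.exp (-(π * x / 2 / 2)) := by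
    refine le_trans ?_ h5
    nlinarith
  refine (abs_add_le _ _).trans ?_
  rw [abs_mul, abs_of_pos (a := 1 / x * (2 / π) * (q * p)) (by positivity), abs_mul, abs_mul _ (2 / π),
    abs_of_pos h0, abs_of_pos (a := 2 / π) (by positivity)]
  calc _ ≤ (t * x) ^ 2 / 2 * (1 / x * 1 * (8192 * Real.exp (-(π * x / 2 / 2))))
        + t ^ 2 * x * 1 * (8192 * Real.exp (-(π * x / 2 / 2))) := by gcongr
    _ = t ^ 2 * (3 / 2) * 8192 * (x * Real.exp (-(π * x / 2 / 2))) := by field_simp; try ring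
    _ ≤ _ := by gcongr; norm_num

lemma FF_deriv (t x : ℝ) (hx : 0 < x) : HasDerivAt (FF t)
    ((Real.cos (t * x) - 1) * (π / 4) * (1 / Real.sinh (π * x / 2)) *
        (π * x * (Real.cosh (π * x / 2) / Real.sinh (π * x / 2)) ^ 2
          - 2 * (Real.cosh (π * x / 2) / Real.sinh (π * x / 2))
          + π * x * (1 / Real.sinh (π * x / 2)) ^ 2)
      + (t * (Real.sin (t * x) * (1 / Real.sinh (π * x / 2)))
        + t ^ 2 * (x * Real.cos (t * x) * (1 / Real.sinh (π * x / 2))))) x := by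
  have hu : 0 < π * x / 2 := by positivity
  have hs : Real.sinh (π * x / 2) ≠ 0 := (Real.sinh_pos_iff.2 hu).ne'
  have d0 : HasDerivAt (fun x : ℝ => π * x / 2) (π * 1 / 2) x := ((hasDerivAt_id x).const_mul π).div_const 2
  have dt : HasDerivAt (fun x : ℝ => t * x) (t * 1) x := (hasDerivAt_id x).const_mul t
  have dS := d0.sinh
  have dC := d0.cosh
  have h := (((dt.cos.sub_const 1).neg).mul ((hasDerivAt_id x).mul ((dC.div (dS.pow 2) (pow_ne_zero 2 hs)).const_mul (π / 2)))).add
    ((dt.mul dt.sin).mul ((hasDerivAt_const x (1:ℝ)).div dS hs))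
  have hh : HasDerivAt (FF t) _ x := h
  refine hh.congr_deriv ?_
  simp only [id, Pi.pow_apply, Pi.mul_apply, Pi.neg_apply, Pi.div_apply]
  clear h hh dS dC
  have hcs := Real.cosh_sq (π * x / 2)
  generalize Real.sinh (π * x / 2) = S at *
  generalize Real.cosh (π * x / 2) = K at *
  field_simp
  linear_combination 4 * x * π ^ 2 * S * (Real.cos (t * x) - 1) * hcs

lemma FF_zero (t : ℝ) : FF t 0 = 0 := by simp [FF]

lemma total (t : ℝ) : ∫ x in Set.Ioi (0:ℝ), ((Real.cos (t * x) - 1) * (π / 4) * (1 / Real.sinh (π * x / 2)) *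
        (π * x * (Real.cosh (π * x / 2) / Real.sinh (π * x / 2)) ^ 2
          - 2 * (Real.cosh (π * x / 2) / Real.sinh (π * x / 2))
          + π * x * (1 / Real.sinh (π * x / 2)) ^ 2)
      + (t * (Real.sin (t * x) * (1 / Real.sinh (π * x / 2)))
        + t ^ 2 * (x * Real.cos (t * x) * (1 / Real.sinh (π * x / 2))))) = 0 := by
  have h := integral_Ioi_of_hasDerivAt_of_tendsto (f := FF t) (a := 0) (m := 0) ?_ (fun x hx => FF_deriv t x hx)
    ((main_integrable t).add (((sin_csch_integrable t).const_mul t).add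
      ((cos_csch_integral t).1.const_mul (t ^ 2)))) ?_
  · rw [h, FF_zero, sub_zero]
  · rw [ContinuousWithinAt, FF_zero]
    refine squeeze_zero_norm' (a := fun x => t ^ 2 * 2 * 8192 * (x * Real.exp (-(π * x / 2 / 2)))) ?_ ?_
    · filter_upwards [self_mem_nhdsWithin] with x hx
      exact FF_bd t x hx
    · have : Continuous (fun x : ℝ => t ^ 2 * 2 * 8192 * (x * Real.exp (-(π * x / 2 / 2)))) := by fun_prop
      have := this.tendsto 0
      simp only [zero_mul, mul_zero] at this
      exact this.mono_left nhdsWithin_le_nhds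
  · refine squeeze_zero_norm' (a := fun x => t ^ 2 * 2 * 8192 * (x * Real.exp (-(π * x / 2 / 2)))) ?_ ?_
    · filter_upwards [Filter.eventually_ge_atTop 0] with x hx
      exact FF_bd t x hx
    · have h := (tendsto_rpow_mul_exp_neg_mul_atTop_nhds_zero 1 (π / 4) (by positivity)).const_mul (t ^ 2 * 2 * 8192)
      rw [mul_zero] at h
      refine h.congr fun x => ?_
      rw [Real.rpow_one]
      ring_nf

theorem stmt_5 (t : ℝ) :
    ∫ x in Set.Ioi (0:ℝ),
      (Real.cos (t * x) - 1) * (π / 4) * (1 / Real.sinh (π * x / 2)) *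
        (π * x * (Real.cosh (π * x / 2) / Real.sinh (π * x / 2)) ^ 2
          - 2 * (Real.cosh (π * x / 2) / Real.sinh (π * x / 2))
          + π * x * (1 / Real.sinh (π * x / 2)) ^ 2)
    = -t * Real.tanh t - t ^ 2 * (1 / Real.cosh t) ^ 2 := by
  have h := total t
  have i2 := (sin_csch_integrable t).const_mul t
  have i3 := (cos_csch_integral t).1.const_mul (t ^ 2)
  have i4 : Integrable (fun x => t * (Real.sin (t * x) * (1 / Real.sinh (π * x / 2)))
        + t ^ 2 * (x * Real.cos (t * x) * (1 / Real.sinh (π * x / 2))))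
        (volume.restrict (Set.Ioi (0:ℝ))) := i2.add i3
  rw [integral_add (main_integrable t) i4, integral_add i2 i3, integral_const_mul,
    integral_const_mul, sin_csch_integral, (cos_csch_integral t).2] at h
  linarith
end

section
/- For all real t, the integral over ℝ\{0} of (cos(tx) − 1)·(π/8)·sech²(πx/4) dx equals 2t/sinh(2t) − 1 (interpreted as 0 at t = 0). -/
open Real MeasureTheory

lemma aux_w (x : ℝ) : π / 2 * (sigmoid (π / 2 * x) * (1 - sigmoid (π / 2 * x)))
    = (π / 8) * (1 / Real.cosh (π * x / 4)) ^ 2 := by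
  rw [Real.sigmoid_def, Real.cosh_eq]
  have h1 : Real.exp (-(π / 2 * x)) = Real.exp (-(π * x / 4)) ^ 2 := by
    rw [← Real.exp_nat_mul]; congr 1; push_cast; ring
  have h2 : Real.exp (π * x / 4) = (Real.exp (-(π * x / 4)))⁻¹ := by
    rw [← Real.exp_neg, neg_neg]
  rw [h1, h2]
  have := Real.exp_pos (-(π * x / 4))
  generalize Real.exp (-(π * x / 4)) = a at *
  field_simp
  ring

lemma aux_cpow (t x : ℝ) :
    ((sigmoid (π / 2 * x) : ℝ) : ℂ) ^ ((1 + 2 * t / π * Complex.I) - 1 : ℂ)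
      * (1 - ((sigmoid (π / 2 * x) : ℝ) : ℂ)) ^ ((1 - 2 * t / π * Complex.I) - 1 : ℂ)
    = Complex.exp (t * x * Complex.I) := by
  have hp := Real.sigmoid_pos (π / 2 * x)
  have hq : 0 < 1 - sigmoid (π / 2 * x) := sub_pos.2 (Real.sigmoid_lt_one _)
  have hlog : Real.log (sigmoid (π / 2 * x)) - Real.log (1 - sigmoid (π / 2 * x)) = π / 2 * x := by
    rw [← Real.log_div hp.ne' hq.ne']
    have : sigmoid (π / 2 * x) / (1 - sigmoid (π / 2 * x)) = Real.exp (π / 2 * x) := by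
      rw [Real.sigmoid_def, Real.exp_neg]
      have := Real.exp_pos (π / 2 * x)
      generalize Real.exp (π / 2 * x) = a at *
      field_simp
      ring
    rw [this, Real.log_exp]
  have e : (1 - ((sigmoid (π / 2 * x) : ℝ) : ℂ)) = ((1 - sigmoid (π / 2 * x) : ℝ) : ℂ) := by
    push_cast; rfl
  rw [e, Complex.cpow_def_of_ne_zero (by exact_mod_cast hp.ne'),
    Complex.cpow_def_of_ne_zero (by exact_mod_cast hq.ne'), ← Complex.exp_add,
    ← Complex.ofReal_log hp.le, ← Complex.ofReal_log hq.le]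
  congr 1
  have hl : ((Real.log (sigmoid (π / 2 * x)) : ℝ) : ℂ)
      = (Real.log (1 - sigmoid (π / 2 * x)) : ℝ) + π / 2 * x := by
    have : Real.log (sigmoid (π / 2 * x)) = Real.log (1 - sigmoid (π / 2 * x)) + π / 2 * x := by
      linarith
    rw [this]; push_cast; rfl
  rw [hl]
  have : (π : ℂ) ≠ 0 := by exact_mod_cast Real.pi_ne_zero
  field_simp
  ring

lemma aux_main (t : ℝ) :
    Integrable (fun x : ℝ => (((π / 8) * (1 / Real.cosh (π * x / 4)) ^ 2 : ℝ)) •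
      Complex.exp (t * x * Complex.I)) ∧
    ∫ x : ℝ, (((π / 8) * (1 / Real.cosh (π * x / 4)) ^ 2 : ℝ)) • Complex.exp (t * x * Complex.I)
      = Complex.betaIntegral (1 + 2 * t / π * Complex.I) (1 - 2 * t / π * Complex.I) := by
  have hpi : (0 : ℝ) < π / 2 := by positivity
  have hd : ∀ x ∈ (Set.univ : Set ℝ), HasDerivWithinAt (fun x => sigmoid (π / 2 * x))
      ((π / 8) * (1 / Real.cosh (π * x / 4)) ^ 2) Set.univ x := by
    intro x _
    rw [← aux_w]
    have := (Real.hasDerivAt_sigmoid (π / 2 * x)).comp x ((hasDerivAt_id x).const_mul (π / 2))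
    refine HasDerivAt.hasDerivWithinAt ?_
    have e : π / 2 * (sigmoid (π / 2 * x) * (1 - sigmoid (π / 2 * x)))
        = sigmoid (π / 2 * x) * (1 - sigmoid (π / 2 * x)) * (π / 2 * 1) := by ring
    rw [e]
    exact this
  have hinj : Set.InjOn (fun x => sigmoid (π / 2 * x)) Set.univ := by
    intro x _ y _ h
    have := Real.sigmoid_injective h
    exact mul_left_cancel₀ hpi.ne' this
  have him : (fun x => sigmoid (π / 2 * x)) '' Set.univ = Set.Ioo 0 1 := by
    rw [Set.image_univ, ← Real.range_sigmoid]
    ext y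
    constructor
    · rintro ⟨x, rfl⟩; exact ⟨_, rfl⟩
    · rintro ⟨x, rfl⟩; exact ⟨x / (π / 2), by simp only; rw [mul_div_cancel₀ _ hpi.ne']⟩
  have habs : ∀ x : ℝ, |(π / 8) * (1 / Real.cosh (π * x / 4)) ^ 2|
      = (π / 8) * (1 / Real.cosh (π * x / 4)) ^ 2 := fun x => abs_of_nonneg (by positivity)
  let g : ℝ → ℂ := fun p => (p : ℂ) ^ ((1 + 2 * t / π * Complex.I) - 1 : ℂ)
      * (1 - (p : ℂ)) ^ ((1 - 2 * t / π * Complex.I) - 1 : ℂ)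
  have h1 := integrableOn_image_iff_integrableOn_abs_deriv_smul MeasurableSet.univ hd hinj g
  have h2 := integral_image_eq_integral_abs_deriv_smul MeasurableSet.univ hd hinj g
  have hg : ∀ x, g (sigmoid (π / 2 * x)) = Complex.exp (t * x * Complex.I) := aux_cpow t
  simp only [him, habs, hg, integrableOn_univ, Measure.restrict_univ] at h1 h2
  have hc := Complex.betaIntegral_convergent (u := 1 + 2 * t / π * Complex.I)
    (v := 1 - 2 * t / π * Complex.I) (by simp [← Complex.ofReal_ofNat, ← Complex.ofReal_mul, ← Complex.ofReal_div])
    (by simp [← Complex.ofReal_ofNat, ← Complex.ofReal_mul, ← Complex.ofReal_div])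
  constructor
  · apply h1.1
    rw [intervalIntegrable_iff_integrableOn_Ioo_of_le zero_le_one] at hc
    exact hc
  · rw [← h2, Complex.betaIntegral, intervalIntegral.integral_of_le zero_le_one,
      integral_Ioc_eq_integral_Ioo]

lemma aux_beta (t : ℝ) (ht : t ≠ 0) :
    Complex.betaIntegral (1 + 2 * t / π * Complex.I) (1 - 2 * t / π * Complex.I)
      = ((2 * t / Real.sinh (2 * t) : ℝ) : ℂ) := by
  have hpi : (π : ℂ) ≠ 0 := by exact_mod_cast Real.pi_ne_zero
  have htc : (t : ℂ) ≠ 0 := by exact_mod_cast ht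
  have h := Complex.Gamma_mul_Gamma_eq_betaIntegral (s := 1 + 2 * t / π * Complex.I)
    (t := 1 - 2 * t / π * Complex.I) (by simp [← Complex.ofReal_ofNat, ← Complex.ofReal_mul, ← Complex.ofReal_div])
    (by simp [← Complex.ofReal_ofNat, ← Complex.ofReal_mul, ← Complex.ofReal_div])
  have e : (1 + 2 * t / π * Complex.I) + (1 - 2 * t / π * Complex.I) = ((1 : ℕ) : ℂ) + 1 := by
    push_cast; ring
  have hs : (2 * t / π * Complex.I : ℂ) ≠ 0 := by simp [hpi, htc]
  rw [e, Complex.Gamma_nat_eq_factorial, add_comm (1 : ℂ) (2 * t / π * Complex.I),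
    Complex.Gamma_add_one _ hs, mul_assoc, Complex.Gamma_mul_Gamma_one_sub] at h
  have e2 : (π : ℂ) * (2 * t / π * Complex.I) = (2 * t : ℂ) * Complex.I := by field_simp
  rw [e2, Complex.sin_mul_I] at h
  simp only [Nat.factorial_one, Nat.cast_one, one_mul] at h
  rw [add_comm (1 : ℂ) (2 * t / π * Complex.I), ← h]
  have hsh : Complex.sinh (2 * t) ≠ 0 := by
    have : Real.sinh (2 * t) ≠ 0 := by simpa [Real.sinh_eq_zero] using ht
    exact_mod_cast this
  push_cast
  field_simp

theorem stmt_7 (t : ℝ) :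
    ∫ x in ({0}ᶜ : Set ℝ),
      (Real.cos (t * x) - 1) * (π / 8) * (1 / Real.cosh (π * x / 4)) ^ 2
    = if t = 0 then 0 else 2 * t / Real.sinh (2 * t) - 1 := by
  split_ifs with ht
  · simp [ht]
  rw [restrict_compl_singleton]
  have hre : ∀ s x : ℝ, ((((π / 8) * (1 / Real.cosh (π * x / 4)) ^ 2 : ℝ)) •
      Complex.exp (s * x * Complex.I)).re
      = Real.cos (s * x) * (π / 8) * (1 / Real.cosh (π * x / 4)) ^ 2 := by
    intro s x
    rw [Complex.smul_re, ← Complex.ofReal_mul, Complex.exp_ofReal_mul_I_re, smul_eq_mul]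
    ring
  obtain ⟨i1, v1⟩ := aux_main t
  obtain ⟨i0, v0⟩ := aux_main 0
  have r1 := integral_re i1
  have r0 := integral_re i0
  have j1 := i1.re
  have j0 := i0.re
  rw [v1, aux_beta t ht] at r1
  have hb : Complex.betaIntegral 1 1 = 1 := by
    rw [Complex.betaIntegral_eval_one_right] <;> simp
  rw [v0] at r0
  simp only [RCLike.re_eq_complex_re, hre, Complex.ofReal_re] at r1 r0 j1 j0
  simp only [Complex.ofReal_zero, mul_zero, zero_div, zero_mul, add_zero, sub_zero, hb,
    Complex.one_re] at r0 j0
  have hsub := integral_sub j1 j0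
  rw [r1, r0] at hsub
  rw [← hsub]
  congr 1
  ext x
  simp only [Real.cos_zero]
  ring
end

section
/- For a > 0, −π < b < π, and all real t, the integral over ℝ\{0} of (cos(tx) − 1)·(1/(4a))·e^{bx/a}·[e^{πx/a}(π − b) + e^{−πx/a}(π + b)]/sinh²(πx/a) dx equals −(at/2)·sinh(at)/(cosh(at) + cos(b)). -/
open Real MeasureTheory

lemma key_bound (ε : ℝ) (hε : 0 < ε) : ∃ C : ℝ, 0 < C ∧ ∀ y : ℝ, 0 < y →
    y / Real.sinh (π * y) ≤ C * Real.exp (-(π - ε) * y) := by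
  have hpi := Real.pi_pos
  refine ⟨(1 + 2 * π / ε) / π, by positivity, fun y hy => ?_⟩
  have hs : 0 < Real.sinh (π * y) := Real.sinh_pos_iff.2 (by positivity)
  rw [div_le_iff₀ hs, Real.sinh_eq]
  have e1 : Real.exp (-(π - ε) * y) = Real.exp (ε * y) * Real.exp (-(π * y)) := by
    rw [← Real.exp_add]; congr 1; ring
  have e2 : Real.exp (-(π * y)) * Real.exp (π * y) = 1 := by
    rw [← Real.exp_add]; simp
  have h1 : 1 + 2 * π * y ≤ (1 + 2 * π / ε) * Real.exp (ε * y) := by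
    have := Real.add_one_le_exp (ε * y)
    calc 1 + 2 * π * y ≤ (1 + 2 * π / ε) * (ε * y + 1) := by
          have : (1 + 2 * π / ε) * (ε * y + 1) = 1 + 2 * π * y + ε * y + 2 * π / ε := by
            field_simp; ring
          rw [this]
          have : 0 < ε * y + 2 * π / ε := by positivity
          linarith
      _ ≤ _ := by gcongr
  have h2 : 2 * π * y + 1 ≤ Real.exp (π * y) * Real.exp (π * y) := by
    have := Real.add_one_le_exp (2 * π * y)
    rw [← Real.exp_add]
    convert this using 2; ring
  set E := Real.exp (π * y)
  set F := Real.exp (-(π * y))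
  have hF : 0 < F := Real.exp_pos _
  have h3 : F * F * (2 * π * y + 1) ≤ 1 := by
    calc F * F * (2 * π * y + 1) ≤ F * F * (E * E) := by gcongr
      _ = (F * E) ^ 2 := by ring
      _ = 1 := by rw [e2]; norm_num
  have hFF : F * F ≤ 1 := by nlinarith [mul_pos hF hF, mul_pos hpi hy]
  rw [e1]
  have : (1 + 2 * π / ε) / π * (Real.exp (ε * y) * F) * ((E - F) / 2)
      = ((1 + 2 * π / ε) * Real.exp (ε * y)) * (F * E - F * F) / (2 * π) := by
    field_simp
  rw [this, e2, le_div_iff₀ (by positivity)]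
  calc y * (2 * π) ≤ (1 + 2 * π * y) * (1 - F * F) := by linarith
    _ ≤ _ := by
      apply mul_le_mul_of_nonneg_right h1; linarith

/-- density -/
lemma G_bound (b : ℝ) (hb' : b < π) : ∃ C δ : ℝ, 0 < C ∧ 0 < δ ∧ ∀ y : ℝ, 0 < y →
    y * (Real.exp (b * y) / Real.sinh (π * y)) ≤ C * Real.exp (-δ * y) ∧
    y ^ 2 * (Real.exp (b * y) * Real.exp (π * y) / Real.sinh (π * y) ^ 2) ≤ C * Real.exp (-δ * y) := by
  obtain ⟨C, hC, h⟩ := key_bound ((π - b) / 4) (by linarith)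
  refine ⟨C + C ^ 2, (π - b) / 2, by positivity, by linarith, fun y hy => ?_⟩
  have hs : 0 < Real.sinh (π * y) := Real.sinh_pos_iff.2 (by have := Real.pi_pos; positivity)
  have hy0 := h y hy
  constructor
  · calc y * (Real.exp (b * y) / Real.sinh (π * y)) 
        = (y / Real.sinh (π * y)) * Real.exp (b * y) := by ring
      _ ≤ (C * Real.exp (-(π - (π - b) / 4) * y)) * Real.exp (b * y) := by gcongr
      _ = C * Real.exp (-(π - (π - b) / 4) * y + b * y) := by rw [Real.exp_add]; ring
      _ ≤ (C + C ^ 2) * Real.exp (-((π - b) / 2) * y) := by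
        gcongr
        · nlinarith
        · nlinarith [mul_pos (sub_pos.2 hb') hy]
  · calc y ^ 2 * (Real.exp (b * y) * Real.exp (π * y) / Real.sinh (π * y) ^ 2)
        = (y / Real.sinh (π * y)) ^ 2 * (Real.exp (b * y) * Real.exp (π * y)) := by ring
      _ ≤ (C * Real.exp (-(π - (π - b) / 4) * y)) ^ 2 * (Real.exp (b * y) * Real.exp (π * y)) := by
        gcongr
      _ = C ^ 2 * (Real.exp (-(π - (π - b) / 4) * y + -(π - (π - b) / 4) * y + (b * y + π * y))) := by
        rw [Real.exp_add, Real.exp_add, Real.exp_add (b * y)]; ring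
      _ ≤ (C + C ^ 2) * Real.exp (-((π - b) / 2) * y) := by
        gcongr
        · nlinarith
        · nlinarith [mul_pos (sub_pos.2 hb') hy]

/-- density -/
noncomputable def dens (b y : ℝ) : ℝ :=
  Real.exp (b * y) * (π * Real.cosh (π * y) - b * Real.sinh (π * y)) / (2 * Real.sinh (π * y) ^ 2)

lemma sinI (b s : ℝ) (hb' : b < π) : IntegrableOn
    (fun y => Real.sin (s * y) * (Real.exp (b * y) / Real.sinh (π * y))) (Set.Ioi 0) := by
  obtain ⟨C, δ, hC, hδ, h⟩ := G_bound b hb'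
  have hi : IntegrableOn (fun y : ℝ => |s| * (C * Real.exp (-δ * y))) (Set.Ioi 0) :=
    ((integrableOn_exp_mul_Ioi (by linarith) 0).const_mul C).const_mul _
  refine Integrable.mono' hi (by fun_prop) ?_
  refine (ae_restrict_iff' measurableSet_Ioi).2 (Filter.Eventually.of_forall fun y hy => ?_)
  have hy : 0 < y := hy
  have hs : 0 < Real.sinh (π * y) := Real.sinh_pos_iff.2 (by have := Real.pi_pos; positivity)
  rw [norm_mul, Real.norm_eq_abs, Real.norm_eq_abs, abs_of_pos (a := _ / _) (by positivity)]
  have h1 : |Real.sin (s * y)| ≤ |s| * y := by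
    have := Real.abs_sin_le_abs (x := s * y)
    rwa [abs_mul, abs_of_pos hy] at this
  calc _ ≤ |s| * y * (Real.exp (b * y) / Real.sinh (π * y)) := by gcongr
    _ = |s| * (y * (Real.exp (b * y) / Real.sinh (π * y))) := by ring
    _ ≤ _ := mul_le_mul_of_nonneg_left (h y hy).1 (by positivity)

lemma cos_bd (s y : ℝ) : |Real.cos (s * y) - 1| ≤ s ^ 2 * y ^ 2 := by
  rw [abs_le]
  have := Real.one_sub_sq_div_two_le_cos (x := s * y)
  have := Real.cos_le_one (s * y)
  constructor <;> nlinarith [sq_nonneg (s * y)]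

lemma cosI (b s : ℝ) (hb : -π < b) (hb' : b < π) : IntegrableOn
    (fun y => (Real.cos (s * y) - 1) * dens b y) (Set.Ioi 0) := by
  obtain ⟨C, δ, hC, hδ, h⟩ := G_bound b hb'
  have hi : IntegrableOn (fun y : ℝ => s ^ 2 * π * (C * Real.exp (-δ * y))) (Set.Ioi 0) :=
    ((integrableOn_exp_mul_Ioi (by linarith) 0).const_mul C).const_mul _
  refine Integrable.mono' hi (by unfold dens; fun_prop) ?_
  refine (ae_restrict_iff' measurableSet_Ioi).2 (Filter.Eventually.of_forall fun y hy => ?_)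
  have hy : 0 < y := hy
  have hs : 0 < Real.sinh (π * y) := Real.sinh_pos_iff.2 (by have := Real.pi_pos; positivity)
  have h1 := cos_bd s y
  have h2 : |dens b y| ≤ π * (Real.exp (b * y) * Real.exp (π * y) / Real.sinh (π * y) ^ 2) := by
    have hc : |π * Real.cosh (π * y) - b * Real.sinh (π * y)| ≤ 2 * π * Real.exp (π * y) := by
      have e := Real.cosh_add_sinh (π * y)
      have e' := Real.cosh_pos (π * y)
      have : Real.sinh (π * y) < Real.cosh (π * y) := Real.sinh_lt_cosh _
      rw [← e, abs_le]
      constructor <;> nlinarith [Real.pi_pos, mul_pos (sub_pos.2 hb') hs, mul_pos (sub_pos.2 hb) hs, mul_pos Real.pi_pos hs, mul_pos Real.pi_pos e']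
    unfold dens
    rw [abs_div, abs_mul, abs_of_pos (Real.exp_pos _), abs_of_pos (a := 2 * _) (by positivity)]
    rw [div_le_iff₀ (by positivity)]
    calc _ ≤ Real.exp (b * y) * (2 * π * Real.exp (π * y)) := by gcongr
      _ = _ := by field_simp
  rw [norm_mul, Real.norm_eq_abs, Real.norm_eq_abs]
  have := (h y hy).2
  calc _ ≤ (s ^ 2 * y ^ 2) * (π * (Real.exp (b * y) * Real.exp (π * y) / Real.sinh (π * y) ^ 2)) := by gcongr
    _ = s ^ 2 * π * (y ^ 2 * (Real.exp (b * y) * Real.exp (π * y) / Real.sinh (π * y) ^ 2)) := by ring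
    _ ≤ _ := by have := Real.pi_pos; gcongr

lemma half (b s : ℝ) (hb : -π < b) (hb' : b < π) :
    ∫ y in Set.Ioi (0:ℝ), (Real.cos (s * y) - 1) * dens b y =
      -(s / 2) * ∫ y in Set.Ioi (0:ℝ), Real.sin (s * y) * (Real.exp (b * y) / Real.sinh (π * y)) := by
  obtain ⟨C, δ, hC, hδ, h⟩ := G_bound b hb'
  have hI1 := cosI b s hb hb'
  have hI2 := (sinI b s hb').const_mul (s / 2)
  set f : ℝ → ℝ := fun y => -(1 / 2) * ((Real.cos (s * y) - 1) * (Real.exp (b * y) / Real.sinh (π * y))) with hf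
  have hbd : ∀ y, 0 < y → ‖f y‖ ≤ s ^ 2 * y * (C * Real.exp (-δ * y)) := by
    intro y hy
    have hs : 0 < Real.sinh (π * y) := Real.sinh_pos_iff.2 (by have := Real.pi_pos; positivity)
    rw [hf]
    simp only [norm_mul, Real.norm_eq_abs]
    rw [abs_of_pos (a := _ / Real.sinh _) (by positivity)]
    have h2 : |(-(1/2) : ℝ)| ≤ 1 := by norm_num [abs_le]
    calc _ ≤ 1 * ((s ^ 2 * y ^ 2) * (Real.exp (b * y) / Real.sinh (π * y))) := by
          gcongr; exact cos_bd s y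
      _ = s ^ 2 * y * (y * (Real.exp (b * y) / Real.sinh (π * y))) := by ring
      _ ≤ _ := mul_le_mul_of_nonneg_left (h y hy).1 (by positivity)
  have key := integral_Ioi_of_hasDerivAt_of_tendsto (a := 0) (m := 0) (f := f)
    (f' := fun y => s / 2 * (Real.sin (s * y) * (Real.exp (b * y) / Real.sinh (π * y))) + (Real.cos (s * y) - 1) * dens b y) ?_ ?_ (hI2.add hI1) ?_
  · rw [integral_add hI2 hI1, integral_const_mul] at key
    simp [hf] at key
    linarith
  · have f0 : f 0 = 0 := by simp [hf]
    rw [ContinuousWithinAt, f0]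
    refine squeeze_zero_norm' (a := fun y => s ^ 2 * y * (C * Real.exp (-δ * y))) ?_ ?_
    · filter_upwards [self_mem_nhdsWithin] with y hy
      rcases eq_or_lt_of_le (show (0:ℝ) ≤ y from hy) with h0 | h0
      · subst h0; simp [f0]
      · exact hbd y h0
    · have : Continuous (fun y : ℝ => s ^ 2 * y * (C * Real.exp (-δ * y))) := by fun_prop
      have := this.tendsto 0
      simp only [mul_zero, zero_mul] at this
      exact this.mono_left nhdsWithin_le_nhds
  · intro y hy
    have hy : 0 < y := hy
    have hs : 0 < Real.sinh (π * y) := Real.sinh_pos_iff.2 (by have := Real.pi_pos; positivity)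
    have l (c : ℝ) : HasDerivAt (fun y : ℝ => c * y) c y := by simpa using (hasDerivAt_id y).const_mul c
    have := ((((l s).cos.sub_const 1).mul ((l b).exp.div (l π).sinh hs.ne')).const_mul (-(1/2)))
    refine this.congr_deriv ?_
    unfold dens
    simp only [Pi.div_apply]
    field_simp
    ring
  · refine squeeze_zero_norm' (a := fun y => s ^ 2 * y * (C * Real.exp (-δ * y))) ?_ ?_
    · filter_upwards [Filter.eventually_gt_atTop 0] with y hy using hbd y hy
    · have := (tendsto_rpow_mul_exp_neg_mul_atTop_nhds_zero 1 δ hδ).const_mul (s ^ 2 * C)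
      simp only [mul_zero, Real.rpow_one] at this
      refine this.congr fun y => by ring

lemma hs_congr {f g : ℕ → ℝ} {x : ℝ} (h : ∀ n, f n = g n) : HasSum f x ↔ HasSum g x := by
  rw [funext h]

lemma int_sin_exp (c s : ℝ) (hc : 0 < c) :
    ∫ y in Set.Ioi (0:ℝ), Real.sin (s * y) * Real.exp (-c * y) = s / (c ^ 2 + s ^ 2) := by
  have hre : ((-c : ℂ) + s * Complex.I).re < 0 := by simpa using hc
  have h := integral_exp_mul_complex_Ioi hre 0
  have hint : IntegrableOn (fun x : ℝ => Complex.exp (((-c : ℂ) + s * Complex.I) * x)) (Set.Ioi 0) :=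
    integrableOn_exp_mul_complex_Ioi hre 0
  have him : ∀ y : ℝ, Real.sin (s * y) * Real.exp (-c * y) =
      Complex.imCLM (Complex.exp (((-c : ℂ) + s * Complex.I) * y)) := by
    intro y
    simp [Complex.exp_im]
    ring
  simp_rw [him]
  rw [ContinuousLinearMap.integral_comp_comm _ hint, h]
  simp [Complex.div_im, Complex.normSq_apply]
  ring

lemma series (b s : ℝ) (hb' : b < π) :
    HasSum (fun n : ℕ => 2 * s / (((2 * n + 1) * π - b) ^ 2 + s ^ 2))
      (∫ y in Set.Ioi (0:ℝ), Real.sin (s * y) * (Real.exp (b * y) / Real.sinh (π * y))) := by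
  set F : ℕ → ℝ → ℝ := fun n y => 2 * (Real.sin (s * y) * Real.exp (-((2 * n + 1) * π - b) * y)) with hF
  have hgeo : ∀ y : ℝ, 0 < y → HasSum (fun n : ℕ => 2 * Real.exp (-((2 * n + 1) * π - b) * y))
      (Real.exp (b * y) / Real.sinh (π * y)) := by
    intro y hy
    have hpy : 0 < π * y := by have := Real.pi_pos; positivity
    have hr : Real.exp (-(2 * (π * y))) < 1 := by rw [Real.exp_lt_one_iff]; linarith
    have := (hasSum_geometric_of_lt_one (Real.exp_pos _).le hr).mul_left
      (2 * Real.exp (b * y) * Real.exp (-(π * y)))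
    have e0 : Real.exp (b * y) / Real.sinh (π * y) = 2 * Real.exp (b * y) * Real.exp (-(π * y)) *
        (1 - Real.exp (-(2 * (π * y))))⁻¹ := by
      have hs : 0 < Real.sinh (π * y) := Real.sinh_pos_iff.2 hpy
      have e2 : Real.exp (-(π * y)) * Real.exp (π * y) = 1 := by
        rw [← Real.exp_add]; simp
      have e3 : Real.exp (-(2 * (π * y))) = Real.exp (-(π * y)) * Real.exp (-(π * y)) := by
        rw [← Real.exp_add]; congr 1; ring
      have h1 : 0 < 1 - Real.exp (-(2 * (π * y))) := by linarith
      rw [← div_eq_mul_inv, div_eq_div_iff hs.ne' h1.ne', e3, Real.sinh_eq]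
      linear_combination (- Real.exp (b * y)) * e2
    rw [e0]
    refine (hs_congr fun n => ?_).2 this
    · rw [← Real.exp_nat_mul, mul_assoc, mul_assoc, ← Real.exp_add, ← Real.exp_add]
      congr 2; ring
  have key := hasSum_integral_of_dominated_convergence (μ := volume.restrict (Set.Ioi (0:ℝ))) (F := F)
    (f := fun y => Real.sin (s * y) * (Real.exp (b * y) / Real.sinh (π * y)))
    (fun n y => |F n y|) (fun n => by rw [hF]; fun_prop) (fun n => by simp) ?_ ?_ ?_
  · refine (hs_congr fun n => ?_).2 key
    rw [hF]
    simp only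
    have hc : 0 < (2 * (n:ℝ) + 1) * π - b := by
      have : 0 ≤ (n:ℝ) * π := by have := Real.pi_pos; positivity
      nlinarith
    rw [integral_const_mul, int_sin_exp _ _ hc]
    ring
  · refine (ae_restrict_iff' measurableSet_Ioi).2 (Filter.Eventually.of_forall fun y hy => ?_)
    refine ((hgeo y hy).summable.mul_left |Real.sin (s * y)|).congr fun n => ?_
    simp only [hF, abs_mul, abs_two, Real.abs_exp]; ring
  · refine (sinI b s hb').norm.congr ?_
    refine (ae_restrict_iff' measurableSet_Ioi).2 (Filter.Eventually.of_forall fun y hy => ?_)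
    have hs : 0 < Real.sinh (π * y) := Real.sinh_pos_iff.2 (mul_pos Real.pi_pos hy)
    have := ((hgeo y hy).mul_left |Real.sin (s * y)|).tsum_eq
    simp only [norm_mul, Real.norm_eq_abs]
    rw [abs_of_pos (a := _ / Real.sinh _) (by positivity), ← this]
    refine tsum_congr fun n => ?_
    simp only [hF, abs_mul, abs_two, Real.abs_exp]; ring
  · refine (ae_restrict_iff' measurableSet_Ioi).2 (Filter.Eventually.of_forall fun y hy => ?_)
    refine (hs_congr fun n => ?_).2 ((hgeo y hy).mul_left (Real.sin (s * y)))
    simp only [hF]; ring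

lemma im_cot (b s : ℝ) (hb : -π < b) (hb' : b < π) :
    (Complex.cot (π / 2 - ((b / 2 : ℝ) + (s / 2 : ℝ) * Complex.I))).im
      = Real.sinh s / (Real.cosh s + Real.cos b) := by
  have hcb : 0 < Real.cosh s + Real.cos b := by
    have h1 := Real.one_le_cosh s
    have h2 : -1 < Real.cos b := by
      have := Real.cos_pos_of_mem_Ioo (x := b / 2) ⟨by linarith, by linarith⟩
      have h3 := Real.cos_sq (b / 2)
      rw [show 2 * (b / 2) = b by ring] at h3
      nlinarith
    linarith
  rw [Complex.cot, Complex.cos_pi_div_two_sub, Complex.sin_pi_div_two_sub, Complex.sin_add_mul_I,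
    Complex.cos_add_mul_I, Complex.div_im]
  simp only [← Complex.ofReal_sin, ← Complex.ofReal_cos, ← Complex.ofReal_sinh, ← Complex.ofReal_cosh]
  simp only [Complex.normSq_apply, Complex.add_re, Complex.add_im, Complex.sub_re, Complex.sub_im, 
    Complex.mul_re, Complex.mul_im, Complex.ofReal_re, Complex.ofReal_im, Complex.I_re, Complex.I_im]
  have e1 : Real.sinh s = 2 * Real.sinh (s / 2) * Real.cosh (s / 2) := by
    rw [← Real.sinh_two_mul]; congr 1; ring
  have e2 : Real.cosh s = Real.cosh (s / 2) ^ 2 + Real.sinh (s / 2) ^ 2 := by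
    rw [← Real.cosh_two_mul]; congr 1; ring
  have e3 : Real.cos b = 2 * Real.cos (b / 2) ^ 2 - 1 := by
    rw [← Real.cos_two_mul]; congr 1; ring
  have e4 := Real.sin_sq_add_cos_sq (b / 2)
  have e5 := Real.cosh_sq (s / 2)
  rw [e2, e3] at hcb
  rw [e1, e2, e3]
  set S := Real.sin (b / 2)
  set c := Real.cos (b / 2)
  set H := Real.sinh (s / 2)
  set K := Real.cosh (s / 2)
  have hS : S ^ 2 = 1 - c ^ 2 := by linarith
  rw [← sub_div]
  rw [div_eq_div_iff]
  · ring_nf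
    rw [show K ^ 3 = K ^ 2 * K by ring]
    simp only [hS, e5]
    ring
  · ring_nf
    simp only [hS, e5]
    nlinarith
  · exact hcb.ne'

lemma trig (b s : ℝ) (hb : -π < b) (hb' : b < π) (A B : ℝ)
    (hA : HasSum (fun n : ℕ => 2 * s / (((2 * n + 1) * π - b) ^ 2 + s ^ 2)) A)
    (hB : HasSum (fun n : ℕ => 2 * s / (((2 * n + 1) * π - (-b)) ^ 2 + s ^ 2)) B) :
    A + B = Real.sinh s / (Real.cosh s + Real.cos b) := by
  have hpi := Real.pi_pos
  set z : ℂ := ((1 / 2 - b / (2 * π) : ℝ) : ℂ) + ((-(s / (2 * π)) : ℝ) : ℂ) * Complex.I with hz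
  have hb2 : |b / (2 * π)| < 1 / 2 := by
    rw [abs_lt, lt_div_iff₀ (by positivity), div_lt_iff₀ (by positivity)]
    constructor <;> linarith
  rw [abs_lt] at hb2
  have hmem : z ∈ Complex.integerComplement := by
    rw [Complex.mem_integerComplement_iff]
    rintro ⟨n, hn⟩
    have := congrArg Complex.re hn
    rw [hz, Complex.add_re, Complex.re_ofReal_mul, Complex.ofReal_re, Complex.I_re, Complex.intCast_re] at this
    have h1 : (0:ℝ) < n := by linarith
    have h2 : (n:ℝ) < 1 := by linarith
    have h1 : 0 < n := by exact_mod_cast h1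
    have h2 : n < 1 := by exact_mod_cast h2
    omega
  have hsum : HasSum (fun n : ℕ => 1 / (z - (n + 1)) + 1 / (z + (n + 1))) (π * Complex.cot (π * z) - 1 / z) := by
    rw [cot_series_rep' hmem]
    exact (summable_cotTerm hmem).hasSum
  have him := Complex.hasSum_im hsum
  have hpz : (π * z : ℂ) = π / 2 - ((b / 2 : ℝ) + (s / 2 : ℝ) * Complex.I) := by
    have : (π : ℂ) ≠ 0 := by exact_mod_cast hpi.ne'
    rw [hz]; push_cast; field_simp; ring
  rw [hpz] at him
  rw [Complex.sub_im, Complex.im_ofReal_mul, im_cot b s hb hb'] at him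
  have hinv : ∀ r : ℝ, (1 / (z + r)).im = π * (2 * s / (((2 * r + 1) * π - b) ^ 2 + s ^ 2)) := by
    intro r
    have hre : (z + r).re = ((2 * r + 1) * π - b) / (2 * π) := by
      rw [hz, Complex.add_re, Complex.add_re, Complex.re_ofReal_mul, Complex.ofReal_re, Complex.I_re,
        Complex.ofReal_re]
      field_simp; ring
    have him : (z + r).im = - s / (2 * π) := by
      rw [hz, Complex.add_im, Complex.add_im, Complex.im_ofReal_mul, Complex.ofReal_im, Complex.I_im,
        Complex.ofReal_im]
      ring
    have hn : Complex.normSq (z + r) = (((2 * r + 1) * π - b) ^ 2 + s ^ 2) / (4 * π ^ 2) := by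
      rw [Complex.normSq_apply, hre, him]; field_simp; ring
    rw [one_div, Complex.inv_im, hn, him]
    generalize ((2 * r + 1) * π - b) ^ 2 + s ^ 2 = D
    field_simp
    ring
  have h0 := hinv 0
  simp only [Complex.ofReal_zero, add_zero] at h0
  rw [h0] at him
  have hA' := (hasSum_nat_add_iff' 1).2 hA
  have hAB := (hA'.add hB).mul_left π
  have heq := hAB.unique ((hs_congr fun n => ?_).2 him)
  · simp only [Finset.sum_range_one, Nat.cast_zero, mul_zero] at heq
    have := mul_left_cancel₀ hpi.ne' (heq.trans (mul_sub _ _ _).symm)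
    linarith
  · have h1 := hinv (-(n + 1))
    have h2 := hinv (n + 1)
    push_cast at h1 h2
    rw [Complex.add_im, sub_eq_add_neg z, h1, h2]
    push_cast
    rw [show (2 * -((n:ℝ) + 1) + 1) * π - b = -((2 * n + 1) * π - -b) by ring, neg_sq]
    ring

lemma dens_neg (b y : ℝ) : dens b (-y) = dens (-b) y := by
  unfold dens
  rw [mul_neg π, Real.cosh_neg, Real.sinh_neg, neg_sq, mul_neg b, neg_mul b]
  ring

lemma full (b s : ℝ) (hb : -π < b) (hb' : b < π) :
    ∫ y : ℝ, (Real.cos (s * y) - 1) * dens b y =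
      -(s / 2) * (Real.sinh s / (Real.cosh s + Real.cos b)) := by
  have hbn : -π < -b := by linarith
  have hbn' : -b < π := by linarith
  have h1 := cosI b s hb hb'
  have h2 := cosI (-b) s hbn hbn'
  have e : ∀ y : ℝ, (Real.cos (s * -y) - 1) * dens (-b) (-y) = (Real.cos (s * y) - 1) * dens b y := by
    intro y
    rw [dens_neg, neg_neg, mul_neg, Real.cos_neg]
  have h3 : IntegrableOn (fun y => (Real.cos (s * y) - 1) * dens b y) (Set.Iic 0) := by
    have := IntegrableOn.comp_neg_Iic (c := (0:ℝ)) (μ := volume)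
      (f := fun y => (Real.cos (s * y) - 1) * dens (-b) y)
      (by rw [neg_zero, integrableOn_Ici_iff_integrableOn_Ioi]; exact h2)
    simpa only [e] using this
  rw [← intervalIntegral.integral_Iic_add_Ioi h3 h1]
  have h4 := integral_comp_neg_Ioi 0 (fun y => (Real.cos (s * y) - 1) * dens b y)
  rw [neg_zero] at h4
  rw [← h4]
  have e' : ∀ y : ℝ, (Real.cos (s * -y) - 1) * dens b (-y) = (Real.cos (s * y) - 1) * dens (-b) y := by
    intro y
    rw [dens_neg, mul_neg, Real.cos_neg]
  simp only [e']
  rw [half b s hb hb', half (-b) s hbn hbn', ← trig b s hb hb' _ _ (series b s hb') (series (-b) s hbn')]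
  ring

theorem stmt_14 (a b : ℝ) (ha : 0 < a) (hb : -π < b) (hb' : b < π) (t : ℝ) :
    ∫ x in ({0}ᶜ : Set ℝ),
      (Real.cos (t * x) - 1) * ((1 / (4 * a)) * Real.exp (b * x / a) *
        (Real.exp (π * x / a) * (π - b) + Real.exp (-(π * x / a)) * (π + b))
          / Real.sinh (π * x / a) ^ 2)
    = -(a * t / 2) * Real.sinh (a * t) / (Real.cosh (a * t) + Real.cos b) := by
  rw [restrict_compl_singleton]
  have e : ∀ x : ℝ, (Real.cos (t * x) - 1) * ((1 / (4 * a)) * Real.exp (b * x / a) *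
        (Real.exp (π * x / a) * (π - b) + Real.exp (-(π * x / a)) * (π + b))
          / Real.sinh (π * x / a) ^ 2) =
      a⁻¹ * (fun y => (Real.cos ((a * t) * y) - 1) * dens b y) (x / a) := by
    intro x
    simp only [dens]
    rw [show a * t * (x / a) = t * x by field_simp, Real.cosh_eq, mul_div_assoc b, mul_div_assoc π]
    have hn : Real.exp (π * (x / a)) * (π - b) + Real.exp (-(π * (x / a))) * (π + b) =
      2 * (π * ((Real.exp (π * (x / a)) + Real.exp (-(π * (x / a)))) / 2) - b * Real.sinh (π * (x / a))) := by
      rw [Real.sinh_eq]; ring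
    rw [hn]
    generalize Real.sinh (π * (x / a)) = S
    field_simp
    try ring
  simp only [e]
  rw [integral_const_mul, Measure.integral_comp_div (fun y => (Real.cos ((a * t) * y) - 1) * dens b y) a, full b (a * t) hb hb', abs_of_pos ha, smul_eq_mul, ← mul_assoc,
    inv_mul_cancel₀ ha.ne']
  ring
end
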